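/- arXiv:0710.0408 — 5 statements merged into one kernel-verified Lean document; each statement's English description precedes it below -/
import Mathlib

section
/- (Existence of a c-concave Kantorovich dual maximizer.) Let M be a Polish metric space, μ and ν Borel probability measures on M, and c : M×M → ℝ a continuous cost function which is bounded below. Assume there exist functions c₁ ∈ L¹(μ) and c₂ ∈ L¹(ν) with c(x,y) ≤ c₁(x) + c₂(y) for all (x,y) ∈ M×M, and that C(μ,ν) < ∞. Then there exists a c-concave function f : M → ℝ∪{−∞} such that f ∈ L¹(μ), its c₁-transform f^{c₁} ∈ L¹(ν), and the pair (f, f^{c₁}) attains the supremum of the dual problem. -/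
open MeasureTheory Set
noncomputable section

/-- The `c₁`-transform `f^{c₁}(y) = inf_x [c(x,y) − f(x)]` of an `ℝ ∪ {−∞}`-valued
function, with the conventions of `EReal` (`c − (−∞) = +∞`). -/
def c1Transform {X : Type*} (c : X → X → ℝ) (f : X → EReal) : X → EReal :=
  fun y => ⨅ x, ((c x y : EReal) - f x)

/-- The `c₂`-transform `f^{c₂}(x) = inf_y [c(x,y) − f(y)]`. -/
def c2Transform {X : Type*} (c : X → X → ℝ) (g : X → EReal) : X → EReal :=
  fun x => ⨅ y, ((c x y : EReal) - g y)

/-- `f` is `c`-concave: `f^{c₁c₂} = f`. -/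
def CConcave {X : Type*} (c : X → X → ℝ) (f : X → EReal) : Prop :=
  c2Transform c (c1Transform c f) = f

/-- A feasible pair for the Kantorovich dual problem: two `ℝ ∪ {−∞}`-valued functions
with `g(x) + h(y) ≤ c(x,y)` for all `x, y`. -/
def DualFeasible {X : Type*} (c : X → X → ℝ) (g h : X → EReal) : Prop :=
  (∀ x, g x ≠ ⊤) ∧ (∀ y, h y ≠ ⊤) ∧ ∀ x y, g x + h y ≤ (c x y : EReal)

/-- An `ℝ ∪ {−∞}`-valued function belongs to `L¹(μ)`: it is almost everywhere
real-valued and integrable. -/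
def ERealL1 {X : Type*} [MeasurableSpace X] (μ : MeasureTheory.Measure X)
    (g : X → EReal) : Prop :=
  (∀ᵐ x ∂μ, g x ≠ ⊥ ∧ g x ≠ ⊤) ∧ MeasureTheory.Integrable (fun x => (g x).toReal) μ

/-- The value `∫ g dμ + ∫ h dν` of the dual problem at the pair `(g,h)`. -/
def dualValue {X : Type*} [MeasurableSpace X] (μ ν : MeasureTheory.Measure X)
    (g h : X → EReal) : ℝ :=
  (∫ x, (g x).toReal ∂μ) + ∫ y, (h y).toReal ∂ν

/-- `(f, f^{c₁})` attains the supremum of the dual problem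
`sup { ∫ g dμ + ∫ h dν : g ∈ L¹(μ), h ∈ L¹(ν), g(x) + h(y) ≤ c(x,y) }`. -/
def AttainsDualSup {X : Type*} [MeasurableSpace X] (μ ν : MeasureTheory.Measure X)
    (c : X → X → ℝ) (f : X → EReal) : Prop :=
  DualFeasible c f (c1Transform c f) ∧ ERealL1 μ f ∧ ERealL1 ν (c1Transform c f) ∧
  ∀ g h : X → EReal, DualFeasible c g h → ERealL1 μ g → ERealL1 ν h →
    dualValue μ ν g h ≤ dualValue μ ν f (c1Transform c f)

section

open Filter Topology

lemma liminf_add_liminf_le_of_tendsto {u v c : ℕ → ENNReal} {C : ENNReal}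
    (h : ∀ n, u n + v n ≤ c n) (hc : Tendsto c atTop (𝓝 C)) :
    liminf u atTop + liminf v atTop ≤ C := by
  have hmono : ∀ f : ℕ → ENNReal, Monotone fun n => ⨅ i ≥ n, f i := fun f m n hmn =>
    le_iInf₂ fun i hi => iInf₂_le i (hmn.trans hi)
  rw [liminf_eq_iSup_iInf_of_nat, liminf_eq_iSup_iInf_of_nat,
    ENNReal.iSup_add_iSup_of_monotone (hmono u) (hmono v)]
  refine iSup_le fun n => ge_of_tendsto hc ?_
  filter_upwards [eventually_ge_atTop n] with i hi
  exact (add_le_add (iInf₂_le i hi) (iInf₂_le i hi)).trans (h i)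

lemma exists_tendstoInMeasure_of_cauchy_sq {X : Type*} [MeasurableSpace X] {μ : Measure X}
    {a : ℕ → X → ℝ} (ha : ∀ n, MemLp (a n) 2 μ)
    (hc : ∀ ε > 0, ∃ N, ∀ m ≥ N, ∀ n ≥ N, ∫ x, (a m x - a n x) ^ 2 ∂μ < ε) :
    ∃ l : X → ℝ, TendstoInMeasure μ a atTop l := by
  have hdist : ∀ m n, dist ((ha m).toLp (a m)) ((ha n).toLp (a n)) ^ 2
      = ∫ x, (a m x - a n x) ^ 2 ∂μ := by
    intro m n
    rw [dist_eq_norm, ← MemLp.toLp_sub, ← real_inner_self_eq_norm_sq, L2.inner_def]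
    refine integral_congr_ae ?_
    filter_upwards [((ha m).sub (ha n)).coeFn_toLp] with x hx
    rw [hx, real_inner_self_eq_norm_sq, Real.norm_eq_abs, sq_abs, Pi.sub_apply]
  have hcau : CauchySeq fun n => (ha n).toLp (a n) := by
    rw [Metric.cauchySeq_iff]
    intro ε hε
    obtain ⟨N, hN⟩ := hc (ε ^ 2) (by positivity)
    refine ⟨N, fun m hm n hn => ?_⟩
    have := hN m hm n hn
    rw [← hdist] at this
    exact lt_of_pow_lt_pow_left₀ 2 hε.le this
  obtain ⟨l, hl⟩ := cauchySeq_tendsto_of_complete hcau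
  exact ⟨l, (tendstoInMeasure_of_tendsto_Lp hl).congr_left fun n => (ha n).coeFn_toLp⟩

lemma memLp_two_exp_neg_half {X : Type*} [MeasurableSpace X] {μ : Measure X} [IsFiniteMeasure μ]
    {u : X → ℝ} (hu : AEMeasurable u μ) (h0 : ∀ᵐ x ∂μ, 0 ≤ u x) :
    MemLp (fun x => Real.exp (-(u x) / 2)) 2 μ := by
  refine MemLp.of_bound (C := 1) ?_ ?_
  · exact (Real.measurable_exp.comp_aemeasurable (hu.neg.div_const 2)).aestronglyMeasurable
  · filter_upwards [h0] with x hx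
    rw [Real.norm_eq_abs, Real.abs_exp, Real.exp_le_one_iff]
    linarith

lemma integral_sq_exp_sub {X : Type*} [MeasurableSpace X] {μ : Measure X} [IsFiniteMeasure μ]
    {u v : X → ℝ} (hu : AEMeasurable u μ) (hv : AEMeasurable v μ)
    (hu0 : ∀ᵐ x ∂μ, 0 ≤ u x) (hv0 : ∀ᵐ x ∂μ, 0 ≤ v x) :
    ∫ x, (Real.exp (-(u x) / 2) - Real.exp (-(v x) / 2)) ^ 2 ∂μ
      = ∫ x, Real.exp (-(u x)) ∂μ + ∫ x, Real.exp (-(v x)) ∂μ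
        - 2 * ∫ x, Real.exp (-((u x + v x) / 2)) ∂μ := by
  have hexp : ∀ {w : X → ℝ}, AEMeasurable w μ → (∀ᵐ x ∂μ, 0 ≤ w x) →
      Integrable (fun x => Real.exp (-(w x))) μ := by
    intro w hw hw0
    refine (memLp_two_exp_neg_half hw hw0).integrable_sq.congr (ae_of_all _ fun x => ?_)
    simp only [← Real.exp_nat_mul]
    congr 1
    push_cast
    ring
  have hm : Integrable (fun x => Real.exp (-((u x + v x) / 2))) μ := by
    refine hexp ((hu.add hv).div_const 2) ?_
    filter_upwards [hu0, hv0] with x h1 h2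
    linarith
  rw [← integral_const_mul, ← integral_add (hexp hu hu0) (hexp hv hv0),
    ← integral_sub (f := fun x => Real.exp (-(u x)) + Real.exp (-(v x)))
      ((hexp hu hu0).add (hexp hv hv0)) (hm.const_mul 2)]
  congr 1 with x
  have e1 : Real.exp (-(u x)) = Real.exp (-(u x) / 2) ^ 2 := by
    rw [← Real.exp_nat_mul]; congr 1; push_cast; ring
  have e2 : Real.exp (-(v x)) = Real.exp (-(v x) / 2) ^ 2 := by
    rw [← Real.exp_nat_mul]; congr 1; push_cast; ring
  have e3 : Real.exp (-((u x + v x) / 2)) = Real.exp (-(u x) / 2) * Real.exp (-(v x) / 2) := by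
    rw [← Real.exp_add]; congr 1; ring
  rw [e1, e2, e3]
  ring

/-- A Komlós-type selection: a decreasing sequence of nonempty midpoint-convex sets of pairs of
nonnegative functions admits a selection along which `exp (-u / 2)` and `exp (-v / 2)` converge
almost everywhere. -/
lemma exists_seq_ae_tendsto_exp {X Y : Type*} [MeasurableSpace X] [MeasurableSpace Y]
    {μ : Measure X} {ν : Measure Y} [IsFiniteMeasure μ] [IsFiniteMeasure ν]
    {K : ℕ → Set ((X → ℝ) × (Y → ℝ))} (hne : ∀ n, (K n).Nonempty) (hanti : Antitone K)
    (hmid : ∀ n, ∀ p ∈ K n, ∀ q ∈ K n,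
      ((fun x => (p.1 x + q.1 x) / 2, fun y => (p.2 y + q.2 y) / 2) : (X → ℝ) × (Y → ℝ)) ∈ K n)
    (hm1 : ∀ n, ∀ p ∈ K n, AEMeasurable p.1 μ) (hm2 : ∀ n, ∀ p ∈ K n, AEMeasurable p.2 ν)
    (h01 : ∀ n, ∀ p ∈ K n, ∀ᵐ x ∂μ, 0 ≤ p.1 x) (h02 : ∀ n, ∀ p ∈ K n, ∀ᵐ y ∂ν, 0 ≤ p.2 y) :
    ∃ w : ℕ → (X → ℝ) × (Y → ℝ), (∀ n, w n ∈ K n) ∧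
      (∀ᵐ x ∂μ, ∃ l, Tendsto (fun n => Real.exp (-((w n).1 x) / 2)) atTop (𝓝 l)) ∧
      (∀ᵐ y ∂ν, ∃ l, Tendsto (fun n => Real.exp (-((w n).2 y) / 2)) atTop (𝓝 l)) := by
  set F : (X → ℝ) × (Y → ℝ) → ℝ :=
    fun p => ∫ x, Real.exp (-(p.1 x)) ∂μ + ∫ y, Real.exp (-(p.2 y)) ∂ν with hF
  have hF0 : ∀ p, 0 ≤ F p := fun p =>
    add_nonneg (integral_nonneg fun x => (Real.exp_pos _).le)
      (integral_nonneg fun x => (Real.exp_pos _).le)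
  set J : ℕ → ℝ := fun n => sInf (F '' K n) with hJ
  have hbdd : ∀ n, BddBelow (F '' K n) := fun n =>
    ⟨0, by rintro _ ⟨p, -, rfl⟩; exact hF0 p⟩
  have hJle : ∀ n, ∀ p ∈ K n, J n ≤ F p := fun n p hp => csInf_le (hbdd n) ⟨p, hp, rfl⟩
  have hJmono : Monotone J := fun m n hmn =>
    csInf_le_csInf (hbdd m) ((hne n).image F) (image_mono (hanti hmn))
  have hJbdd : BddAbove (range J) := by
    refine ⟨μ.real univ + ν.real univ, ?_⟩
    rintro _ ⟨n, rfl⟩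
    obtain ⟨p, hp⟩ := hne n
    refine (hJle n p hp).trans (add_le_add ?_ ?_)
    · have := integral_mono_of_nonneg (μ := μ) (f := fun x => Real.exp (-(p.1 x))) (g := fun _ => 1)
        (ae_of_all _ fun x => (Real.exp_pos _).le) (integrable_const _) (by
          filter_upwards [h01 n p hp] with x hx
          simpa using hx)
      simpa using this
    · have := integral_mono_of_nonneg (μ := ν) (f := fun x => Real.exp (-(p.2 x))) (g := fun _ => 1)
        (ae_of_all _ fun x => (Real.exp_pos _).le) (integrable_const _) (by
          filter_upwards [h02 n p hp] with x hx
          simpa using hx)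
      simpa using this
  have hJlim := tendsto_atTop_ciSup hJmono hJbdd
  have hex : ∀ n : ℕ, ∃ p ∈ K n, F p < J n + 1 / ((n : ℝ) + 1) := by
    intro n
    obtain ⟨_, ⟨p, hp, rfl⟩, h⟩ := exists_lt_of_csInf_lt ((hne n).image F)
      (lt_add_of_pos_right (J n) (by positivity : (0 : ℝ) < 1 / ((n : ℝ) + 1)))
    exact ⟨p, hp, h⟩
  choose w hwK hwF using hex
  have hkey : ∀ m n, m ≤ n →
      ∫ x, (Real.exp (-((w m).1 x) / 2) - Real.exp (-((w n).1 x) / 2)) ^ 2 ∂μ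
        + ∫ y, (Real.exp (-((w m).2 y) / 2) - Real.exp (-((w n).2 y) / 2)) ^ 2 ∂ν
      ≤ 2 * ((⨆ k, J k) - J m + 1 / ((m : ℝ) + 1)) := by
    intro m n hmn
    have hn : w n ∈ K m := hanti hmn (hwK n)
    rw [integral_sq_exp_sub (hm1 m _ (hwK m)) (hm1 m _ hn) (h01 m _ (hwK m)) (h01 m _ hn),
      integral_sq_exp_sub (hm2 m _ (hwK m)) (hm2 m _ hn) (h02 m _ (hwK m)) (h02 m _ hn)]
    have h1 := hJle m _ (hmid m _ (hwK m) _ hn)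
    have h2 := hwF m
    have h3 := hwF n
    have h4 : J n ≤ ⨆ k, J k := le_ciSup hJbdd n
    have h5 : 1 / ((n : ℝ) + 1) ≤ 1 / ((m : ℝ) + 1) := by gcongr
    have h6 : J m ≤ ⨆ k, J k := le_ciSup hJbdd m
    simp only [hF] at h1 h2 h3
    linarith
  have hlim : Tendsto (fun m : ℕ => 2 * ((⨆ k, J k) - J m + 1 / ((m : ℝ) + 1))) atTop (𝓝 0) := by
    simpa using
      ((hJlim.const_sub (⨆ k, J k)).add tendsto_one_div_add_atTop_nhds_zero_nat).const_mul 2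
  have hnn1 : ∀ m n, 0 ≤ ∫ x, (Real.exp (-((w m).1 x) / 2) - Real.exp (-((w n).1 x) / 2)) ^ 2 ∂μ :=
    fun m n => integral_nonneg fun x => sq_nonneg _
  have hnn2 : ∀ m n, 0 ≤ ∫ y, (Real.exp (-((w m).2 y) / 2) - Real.exp (-((w n).2 y) / 2)) ^ 2 ∂ν :=
    fun m n => integral_nonneg fun x => sq_nonneg _
  have hc1 : ∃ l : X → ℝ, TendstoInMeasure μ
      (fun n x => Real.exp (-((w n).1 x) / 2)) atTop l := by
    refine exists_tendstoInMeasure_of_cauchy_sq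
      (fun n => memLp_two_exp_neg_half (hm1 n _ (hwK n)) (h01 n _ (hwK n))) fun ε hε => ?_
    obtain ⟨N, hN⟩ := eventually_atTop.1 (hlim.eventually (gt_mem_nhds hε))
    refine ⟨N, fun m hm n hn => ?_⟩
    rcases le_total m n with h | h
    · linarith [hkey m n h, hnn2 m n, hN m hm]
    · simp_rw [sub_sq_comm (Real.exp (-((w m).1 _) / 2))]
      linarith [hkey n m h, hnn2 n m, hN n hn]
  have hc2 : ∃ l : Y → ℝ, TendstoInMeasure ν
      (fun n y => Real.exp (-((w n).2 y) / 2)) atTop l := by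
    refine exists_tendstoInMeasure_of_cauchy_sq
      (fun n => memLp_two_exp_neg_half (hm2 n _ (hwK n)) (h02 n _ (hwK n))) fun ε hε => ?_
    obtain ⟨N, hN⟩ := eventually_atTop.1 (hlim.eventually (gt_mem_nhds hε))
    refine ⟨N, fun m hm n hn => ?_⟩
    rcases le_total m n with h | h
    · linarith [hkey m n h, hnn1 m n, hN m hm]
    · simp_rw [sub_sq_comm (Real.exp (-((w m).2 _) / 2))]
      linarith [hkey n m h, hnn1 n m, hN n hn]
  obtain ⟨l1, hl1⟩ := hc1
  obtain ⟨l2, hl2⟩ := hc2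
  obtain ⟨φ, hφ, hφl⟩ := hl1.exists_seq_tendsto_ae
  obtain ⟨ψ, hψ, hψl⟩ := (hl2.comp hφ.tendsto_atTop).exists_seq_tendsto_ae
  refine ⟨fun n => w (φ (ψ n)), fun n => hanti ((hφ.comp hψ).le_apply) (hwK _), ?_, ?_⟩
  · filter_upwards [hφl] with x hx
    exact ⟨_, hx.comp hψ.tendsto_atTop⟩
  · filter_upwards [hψl] with y hy
    exact ⟨_, hy⟩

lemma tendsto_toReal_liminf_of_exp {u : ℕ → ℝ} (h0 : ∀ n, 0 ≤ u n) {l : ℝ}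
    (hl : Tendsto (fun n => Real.exp (-(u n) / 2)) atTop (𝓝 l))
    (hfin : liminf (fun n => ENNReal.ofReal (u n)) atTop < ⊤) :
    Tendsto u atTop (𝓝 (liminf (fun n => ENNReal.ofReal (u n)) atTop).toReal) := by
  have hl0 : 0 ≤ l := ge_of_tendsto' hl fun n => (Real.exp_pos _).le
  rcases hl0.eq_or_lt with rfl | hpos
  · exfalso
    rw [Real.tendsto_exp_comp_nhds_zero] at hl
    have h1 : Tendsto u atTop atTop := by
      have := hl.const_mul_atBot_of_neg (r := -2) (by norm_num)
      refine this.congr fun n => by ring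
    rw [(ENNReal.tendsto_ofReal_nhds_top.2 h1).liminf_eq] at hfin
    exact lt_irrefl _ hfin
  · have h1 : Tendsto u atTop (𝓝 (-2 * Real.log l)) := by
      refine ((hl.log hpos.ne').const_mul (-2)).congr fun n => ?_
      rw [Real.log_exp]; ring
    rw [(ENNReal.tendsto_ofReal h1).liminf_eq, ENNReal.toReal_ofReal (ge_of_tendsto' h1 h0)]
    exact h1

/-- Pairs of integrable functions which, off null sets, are nonnegative and satisfy
`k x y ≤ u x + v y`. -/
def aePairCover {X Y : Type*} [MeasurableSpace X] [MeasurableSpace Y] (μ : Measure X)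
    (ν : Measure Y) (k : X → Y → ℝ) : Set ((X → ℝ) × (Y → ℝ)) :=
  {p | Integrable p.1 μ ∧ Integrable p.2 ν ∧ ∃ A ∈ ae μ, ∃ B ∈ ae ν,
    (∀ x ∈ A, 0 ≤ p.1 x) ∧ (∀ y ∈ B, 0 ≤ p.2 y) ∧ ∀ x ∈ A, ∀ y ∈ B, k x y ≤ p.1 x + p.2 y}

lemma midpoint_mem_aePairCover {X Y : Type*} [MeasurableSpace X] [MeasurableSpace Y]
    {μ : Measure X} {ν : Measure Y} {k : X → Y → ℝ} {p q : (X → ℝ) × (Y → ℝ)}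
    (hp : p ∈ aePairCover μ ν k) (hq : q ∈ aePairCover μ ν k) :
    ((fun x => (p.1 x + q.1 x) / 2, fun y => (p.2 y + q.2 y) / 2) : (X → ℝ) × (Y → ℝ))
      ∈ aePairCover μ ν k := by
  obtain ⟨hp1, hp2, A, hA, B, hB, hpA, hpB, hpk⟩ := hp
  obtain ⟨hq1, hq2, A', hA', B', hB', hqA, hqB, hqk⟩ := hq
  refine ⟨(hp1.add hq1).div_const 2, (hp2.add hq2).div_const 2, A ∩ A', inter_mem hA hA',
    B ∩ B', inter_mem hB hB', fun x hx => ?_, fun y hy => ?_, fun x hx y hy => ?_⟩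
  · linarith [hpA x hx.1, hqA x hx.2]
  · linarith [hpB y hy.1, hqB y hy.2]
  · linarith [hpk x hx.1 y hy.1, hqk x hx.2 y hy.2]

lemma integral_nonneg_of_mem_aePairCover {X Y : Type*} [MeasurableSpace X] [MeasurableSpace Y]
    {μ : Measure X} {ν : Measure Y} {k : X → Y → ℝ} {p : (X → ℝ) × (Y → ℝ)}
    (hp : p ∈ aePairCover μ ν k) : 0 ≤ ∫ x, p.1 x ∂μ + ∫ y, p.2 y ∂ν := by
  obtain ⟨-, -, A, hA, B, hB, hpA, hpB, -⟩ := hp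
  exact add_nonneg (integral_nonneg_of_ae (mem_of_superset hA hpA))
    (integral_nonneg_of_ae (mem_of_superset hB hpB))

lemma integrable_toReal_liminf {X : Type*} [MeasurableSpace X] {μ : Measure X}
    {u : ℕ → X → ℝ} (hu : ∀ n, AEMeasurable (u n) μ) (h0 : ∀ᵐ x ∂μ, ∀ n, 0 ≤ u n x)
    (hl : ∀ᵐ x ∂μ, ∃ l, Tendsto (fun n => Real.exp (-(u n x) / 2)) atTop (𝓝 l))
    (hfin : ∫⁻ x, liminf (fun n => ENNReal.ofReal (u n x)) atTop ∂μ ≠ ⊤) :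
    (∀ᵐ x ∂μ, Tendsto (fun n => u n x) atTop
      (𝓝 (liminf (fun n => ENNReal.ofReal (u n x)) atTop).toReal)) ∧
    Integrable (fun x => (liminf (fun n => ENNReal.ofReal (u n x)) atTop).toReal) μ ∧
    ∫ x, (liminf (fun n => ENNReal.ofReal (u n x)) atTop).toReal ∂μ
      = (∫⁻ x, liminf (fun n => ENNReal.ofReal (u n x)) atTop ∂μ).toReal := by
  have hm : AEMeasurable (fun x => liminf (fun n => ENNReal.ofReal (u n x)) atTop) μ := by
    refine ⟨fun x => liminf (fun n => ENNReal.ofReal ((hu n).mk (u n) x)) atTop,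
      Measurable.liminf fun n => (hu n).measurable_mk.ennreal_ofReal, ?_⟩
    filter_upwards [ae_all_iff.2 fun n => (hu n).ae_eq_mk] with x hx
    simp only [hx]
  have hlt := ae_lt_top' hm hfin
  refine ⟨?_, integrable_toReal_of_lintegral_ne_top hm hfin, integral_toReal hm hlt⟩
  filter_upwards [h0, hl, hlt] with x hx0 ⟨l, hxl⟩ hxlt
  exact tendsto_toReal_liminf_of_exp hx0 hxl hxlt

lemma exists_minimizer_aePairCover {X Y : Type*} [MeasurableSpace X] [MeasurableSpace Y]
    {μ : Measure X} {ν : Measure Y} [IsFiniteMeasure μ] [IsFiniteMeasure ν] {k : X → Y → ℝ}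
    (hne : (aePairCover μ ν k).Nonempty) :
    ∃ p ∈ aePairCover μ ν k, ∀ q ∈ aePairCover μ ν k,
      ∫ x, p.1 x ∂μ + ∫ y, p.2 y ∂ν ≤ ∫ x, q.1 x ∂μ + ∫ y, q.2 y ∂ν := by
  set G : (X → ℝ) × (Y → ℝ) → ℝ := fun p => ∫ x, p.1 x ∂μ + ∫ y, p.2 y ∂ν with hG
  set I := sInf (G '' aePairCover μ ν k) with hI
  have hbdd : BddBelow (G '' aePairCover μ ν k) :=
    ⟨0, by rintro _ ⟨p, hp, rfl⟩; exact integral_nonneg_of_mem_aePairCover hp⟩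
  have hI0 : 0 ≤ I := le_csInf (hne.image G) (by
    rintro _ ⟨p, hp, rfl⟩; exact integral_nonneg_of_mem_aePairCover hp)
  set K : ℕ → Set ((X → ℝ) × (Y → ℝ)) :=
    fun n => {p | p ∈ aePairCover μ ν k ∧ G p ≤ I + 1 / ((n : ℝ) + 1)} with hK
  have hKne : ∀ n, (K n).Nonempty := by
    intro n
    obtain ⟨_, ⟨p, hp, rfl⟩, h⟩ := exists_lt_of_csInf_lt (hne.image G)
      (lt_add_of_pos_right I (by positivity : (0 : ℝ) < 1 / ((n : ℝ) + 1)))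
    exact ⟨p, hp, h.le⟩
  have hKanti : Antitone K := by
    intro m n hmn p hp
    have h5 : 1 / ((n : ℝ) + 1) ≤ 1 / ((m : ℝ) + 1) := by gcongr
    exact ⟨hp.1, hp.2.trans (by linarith)⟩
  obtain ⟨w, hw, hw1, hw2⟩ := exists_seq_ae_tendsto_exp (μ := μ) (ν := ν) hKne hKanti
    (by
      intro n p hp q hq
      refine ⟨midpoint_mem_aePairCover hp.1 hq.1, ?_⟩
      have hp2 := hp.2
      have hq2 := hq.2
      simp only [hG] at hp2 hq2 ⊢
      rw [integral_div, integral_div, integral_add hp.1.1 hq.1.1, integral_add hp.1.2.1 hq.1.2.1]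
      linarith)
    (fun n p hp => hp.1.1.aemeasurable) (fun n p hp => hp.1.2.1.aemeasurable)
    (fun n p hp => by
      obtain ⟨-, -, A, hA, B, hB, hpA, hpB, -⟩ := hp.1
      exact mem_of_superset hA hpA)
    (fun n p hp => by
      obtain ⟨-, -, A, hA, B, hB, hpA, hpB, -⟩ := hp.1
      exact mem_of_superset hB hpB)
  have hwint1 : ∀ n, Integrable (w n).1 μ := fun n => (hw n).1.1
  have hwint2 : ∀ n, Integrable (w n).2 ν := fun n => (hw n).1.2.1
  choose A hA B hB hwA hwB hwk using fun n => (hw n).1.2.2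
  have hA' : ∀ᵐ x ∂μ, ∀ n, x ∈ A n := ae_all_iff.2 hA
  have hB' : ∀ᵐ y ∂ν, ∀ n, y ∈ B n := ae_all_iff.2 hB
  have h01 : ∀ᵐ x ∂μ, ∀ n, 0 ≤ (w n).1 x := hA'.mono fun x hx n => hwA n x (hx n)
  have h02 : ∀ᵐ y ∂ν, ∀ n, 0 ≤ (w n).2 y := hB'.mono fun y hy n => hwB n y (hy n)
  have hle : ∫⁻ x, liminf (fun n => ENNReal.ofReal ((w n).1 x)) atTop ∂μ
      + ∫⁻ y, liminf (fun n => ENNReal.ofReal ((w n).2 y)) atTop ∂ν ≤ ENNReal.ofReal I := by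
    refine (add_le_add
      (lintegral_liminf_le' fun n => (hwint1 n).aemeasurable.ennreal_ofReal)
      (lintegral_liminf_le' fun n => (hwint2 n).aemeasurable.ennreal_ofReal)).trans ?_
    refine liminf_add_liminf_le_of_tendsto
      (c := fun n : ℕ => ENNReal.ofReal (I + 1 / ((n : ℝ) + 1))) (fun n => ?_) ?_
    · have e1 : 0 ≤ᵐ[μ] (w n).1 := h01.mono fun x hx => hx n
      have e2 : 0 ≤ᵐ[ν] (w n).2 := h02.mono fun x hx => hx n
      rw [← ofReal_integral_eq_lintegral_ofReal (hwint1 n) e1,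
        ← ofReal_integral_eq_lintegral_ofReal (hwint2 n) e2,
        ← ENNReal.ofReal_add (integral_nonneg_of_ae e1) (integral_nonneg_of_ae e2)]
      exact ENNReal.ofReal_le_ofReal (hw n).2
    · exact ENNReal.tendsto_ofReal (by
        simpa using tendsto_one_div_add_atTop_nhds_zero_nat.const_add I)
  have hne1 := ne_top_of_le_ne_top ENNReal.ofReal_ne_top (le_self_add.trans hle)
  have hne2 := ne_top_of_le_ne_top ENNReal.ofReal_ne_top (le_add_self.trans hle)
  obtain ⟨ht1, hi1, he1⟩ := integrable_toReal_liminf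
    (fun n => (hwint1 n).aemeasurable) h01 hw1 hne1
  obtain ⟨ht2, hi2, he2⟩ := integrable_toReal_liminf
    (fun n => (hwint2 n).aemeasurable) h02 hw2 hne2
  refine ⟨(_, _), ⟨hi1, hi2, _, hA'.and ht1, _, hB'.and ht2,
    fun x _ => ENNReal.toReal_nonneg, fun y _ => ENNReal.toReal_nonneg, ?_⟩, fun q hq => ?_⟩
  · rintro x ⟨hxA, hx⟩ y ⟨hyB, hy⟩
    exact ge_of_tendsto' (hx.add hy) fun n => hwk n x (hxA n) y (hyB n)
  · refine le_trans ?_ (csInf_le hbdd ⟨q, hq, rfl⟩)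
    refine (add_le_add he1.le he2.le).trans ?_
    rw [← ENNReal.toReal_add hne1 hne2]
    exact ENNReal.toReal_le_of_le_ofReal hI0 hle

lemma exists_between_sub {X Y : Type*} {A : Set X} {B : Set Y} {g c₁ : X → ℝ} {h c₂ : Y → ℝ}
    (hA : A.Nonempty) (hB : B.Nonempty) (hle : ∀ x ∈ A, ∀ y ∈ B, g x + h y ≤ c₁ x + c₂ y) :
    ∃ t, (∀ x ∈ A, g x + t ≤ c₁ x) ∧ ∀ y ∈ B, h y - t ≤ c₂ y := by
  obtain ⟨y₀, hy₀⟩ := hB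
  refine ⟨sInf ((fun x => c₁ x - g x) '' A), fun x hx => ?_, fun y hy => ?_⟩
  · have hbdd : BddBelow ((fun x => c₁ x - g x) '' A) := by
      refine ⟨h y₀ - c₂ y₀, ?_⟩
      rintro _ ⟨x, hx, rfl⟩
      linarith [hle x hx y₀ hy₀]
    have : sInf ((fun x => c₁ x - g x) '' A) ≤ c₁ x - g x := csInf_le hbdd ⟨x, hx, rfl⟩
    linarith
  · have : h y - c₂ y ≤ sInf ((fun x => c₁ x - g x) '' A) := by
      refine le_csInf (hA.image _) ?_
      rintro _ ⟨x, hx, rfl⟩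
      linarith [hle x hx y hy]
    linarith

/-- Existence of an almost everywhere real-valued maximizer of the dual problem; no topology is
involved. -/
lemma exists_ae_dual_maximizer {X Y : Type*} [MeasurableSpace X] [MeasurableSpace Y]
    {μ : Measure X} {ν : Measure Y} [IsProbabilityMeasure μ] [IsProbabilityMeasure ν]
    {c : X → Y → ℝ} {B₀ : ℝ} (hcbdd : ∀ x y, B₀ ≤ c x y)
    {c₁ : X → ℝ} {c₂ : Y → ℝ} (hc₁ : Integrable c₁ μ) (hc₂ : Integrable c₂ ν)
    (hbound : ∀ x y, c x y ≤ c₁ x + c₂ y) :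
    ∃ (g : X → ℝ) (h : Y → ℝ), ∃ A ∈ ae μ, ∃ B ∈ ae ν, Integrable g μ ∧ Integrable h ν ∧
      (∀ x ∈ A, ∀ y ∈ B, g x + h y ≤ c x y) ∧
      ∀ (g' : X → ℝ) (h' : Y → ℝ), ∀ A' ∈ ae μ, ∀ B' ∈ ae ν, Integrable g' μ → Integrable h' ν →
        (∀ x ∈ A', ∀ y ∈ B', g' x + h' y ≤ c x y) →
        ∫ x, g' x ∂μ + ∫ y, h' y ∂ν ≤ ∫ x, g x ∂μ + ∫ y, h y ∂ν := by
  set k : X → Y → ℝ := fun x y => c₁ x + c₂ y - c x y with hk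
  have hmem : ∀ (g' : X → ℝ) (h' : Y → ℝ), ∀ A' ∈ ae μ, ∀ B' ∈ ae ν, Integrable g' μ →
      Integrable h' ν → (∀ x ∈ A', ∀ y ∈ B', g' x + h' y ≤ c x y) →
      ∃ p ∈ aePairCover μ ν k, ∫ x, p.1 x ∂μ + ∫ y, p.2 y ∂ν
        = ∫ x, c₁ x ∂μ + ∫ y, c₂ y ∂ν - (∫ x, g' x ∂μ + ∫ y, h' y ∂ν) := by
    intro g' h' A' hA' B' hB' hg' hh' hle
    obtain ⟨t, ht1, ht2⟩ := exists_between_sub (g := g') (h := h')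
      (Filter.nonempty_of_mem hA') (Filter.nonempty_of_mem hB')
      (fun x hx y hy => (hle x hx y hy).trans (hbound x y))
    refine ⟨(fun x => c₁ x - (g' x + t), fun y => c₂ y - (h' y - t)),
      ⟨hc₁.sub (hg'.add (integrable_const t)), hc₂.sub (hh'.sub (integrable_const t)),
        A', hA', B', hB', fun x hx => ?_, fun y hy => ?_, fun x hx y hy => ?_⟩, ?_⟩
    · linarith [ht1 x hx]
    · linarith [ht2 y hy]
    · have := hle x hx y hy
      simp only [hk]
      linarith
    · have e1 : ∫ x, (c₁ x - (g' x + t)) ∂μ = ∫ x, c₁ x ∂μ - (∫ x, g' x ∂μ + t) := by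
        rw [integral_sub (g := fun x => g' x + t) hc₁ (hg'.add (integrable_const t)),
          integral_add hg' (integrable_const t)]
        simp
      have e2 : ∫ y, (c₂ y - (h' y - t)) ∂ν = ∫ y, c₂ y ∂ν - (∫ y, h' y ∂ν - t) := by
        rw [integral_sub (g := fun y => h' y - t) hc₂ (hh'.sub (integrable_const t)),
          integral_sub hh' (integrable_const t)]
        simp
      simp only [e1, e2]
      ring
  obtain ⟨p₀, hp₀, -⟩ := hmem (fun _ => 0) (fun _ => B₀) univ univ_mem univ univ_mem
    (integrable_const _) (integrable_const _) (fun x _ y _ => by simpa using hcbdd x y)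
  obtain ⟨p, hp, hmin⟩ := exists_minimizer_aePairCover ⟨p₀, hp₀⟩
  obtain ⟨hp1, hp2, A, hA, B, hB, -, -, hpk⟩ := id hp
  refine ⟨fun x => c₁ x - p.1 x, fun y => c₂ y - p.2 y, A, hA, B, hB, hc₁.sub hp1, hc₂.sub hp2,
    fun x hx y hy => ?_, fun g' h' A' hA' B' hB' hg' hh' hle => ?_⟩
  · have := hpk x hx y hy
    simp only [hk] at this
    linarith
  · obtain ⟨q, hq, hqe⟩ := hmem g' h' A' hA' B' hB' hg' hh' hle
    have := hmin q hq
    rw [integral_sub hc₁ hp1, integral_sub hc₂ hp2]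
    linarith

lemma le_c2Transform_iff {X : Type*} {c : X → X → ℝ} {f g : X → EReal} :
    f ≤ c2Transform c g ↔ ∀ x y, f x + g y ≤ (c x y : EReal) := by
  simp only [Pi.le_def, c2Transform, le_iInf_iff]
  exact forall₂_congr fun x y =>
    EReal.le_sub_iff_add_le (.inr (EReal.coe_ne_bot _)) (.inr (EReal.coe_ne_top _))

lemma le_c1Transform_iff {X : Type*} {c : X → X → ℝ} {f g : X → EReal} :
    g ≤ c1Transform c f ↔ ∀ x y, f x + g y ≤ (c x y : EReal) := by
  simp only [Pi.le_def, c1Transform, le_iInf_iff]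
  rw [forall_comm]
  refine forall₂_congr fun x y => ?_
  rw [add_comm]
  exact EReal.le_sub_iff_add_le (.inr (EReal.coe_ne_bot _)) (.inr (EReal.coe_ne_top _))

lemma cConcave_c2Transform {X : Type*} (c : X → X → ℝ) (g : X → EReal) :
    CConcave c (c2Transform c g) := by
  have h1 : g ≤ c1Transform c (c2Transform c g) :=
    le_c1Transform_iff.2 (le_c2Transform_iff.1 le_rfl)
  refine le_antisymm (fun x => ?_) (le_c2Transform_iff.2 (le_c1Transform_iff.1 le_rfl))
  exact iInf_mono fun y => EReal.sub_le_sub le_rfl (h1 y)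

lemma continuous_coe_sub_const {X : Type*} [TopologicalSpace X] {φ : X → ℝ} (hφ : Continuous φ)
    (a : EReal) : Continuous fun x => (φ x : EReal) - a := by
  induction a with
  | bot => simpa using continuous_const
  | coe a => exact_mod_cast continuous_coe_real_ereal.comp (hφ.sub continuous_const)
  | top => simpa using continuous_const

lemma measurable_iInf_coe_sub {X ι : Type*} [TopologicalSpace X] [MeasurableSpace X]
    [OpensMeasurableSpace X] {φ : ι → X → ℝ} (hφ : ∀ i, Continuous (φ i)) (a : ι → EReal) :
    Measurable fun x => ⨅ i, ((φ i x : EReal) - a i) :=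
  (upperSemicontinuous_iInf fun i =>
    (continuous_coe_sub_const (hφ i) (a i)).upperSemicontinuous).measurable

lemma eRealL1_of_le_of_le {X : Type*} [MeasurableSpace X] {μ : Measure X} {f : X → EReal}
    (hf : Measurable f) {g b : X → ℝ} (hg : Integrable g μ) (hb : Integrable b μ)
    (hgf : ∀ᵐ x ∂μ, (g x : EReal) ≤ f x) (hfb : ∀ x, f x ≤ (b x : EReal)) :
    ERealL1 μ f ∧ ∫ x, g x ∂μ ≤ ∫ x, (f x).toReal ∂μ := by
  have htop : ∀ x, f x ≠ ⊤ := fun x => ne_top_of_le_ne_top (EReal.coe_ne_top _) (hfb x)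
  have hbot : ∀ᵐ x ∂μ, f x ≠ ⊥ := hgf.mono fun x hx =>
    ne_bot_of_le_ne_bot (EReal.coe_ne_bot _) hx
  have hlow : ∀ᵐ x ∂μ, g x ≤ (f x).toReal := by
    filter_upwards [hgf] with x hx
    simpa using EReal.toReal_le_toReal hx (EReal.coe_ne_bot _) (htop x)
  have hup : ∀ᵐ x ∂μ, (f x).toReal ≤ b x := by
    filter_upwards [hbot] with x hx
    simpa using EReal.toReal_le_toReal (hfb x) hx (EReal.coe_ne_top _)
  have hint : Integrable (fun x => (f x).toReal) μ :=
    integrable_of_le_of_le hf.ereal_toReal.aestronglyMeasurable hlow hup hg hb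
  exact ⟨⟨hbot.mono fun x hx => ⟨hx, htop x⟩, hint⟩, integral_mono_ae hg hint hlow⟩

lemma iInf_coe_sub_le {ι : Type*} {φ : ι → ℝ} {a : ι → EReal} {i : ι} {r s : ℝ}
    (hs : (s : EReal) ≤ a i) (hr : φ i ≤ r) :
    ⨅ i, ((φ i : EReal) - a i) ≤ ((r - s : ℝ) : EReal) := by
  refine (iInf_le _ i).trans ?_
  rw [EReal.coe_sub]
  exact EReal.sub_le_sub (EReal.coe_le_coe_iff.2 hr) hs

end

/-- **Existence of a `c`-concave Kantorovich dual maximizer on a Polish space.** -/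
theorem c_concave_dual_maximizer_exists
    {M : Type*} [MetricSpace M] [CompleteSpace M] [TopologicalSpace.SeparableSpace M]
    [MeasurableSpace M] [BorelSpace M]
    (μ ν : Measure M) [IsProbabilityMeasure μ] [IsProbabilityMeasure ν]
    (c : M → M → ℝ) (hccont : Continuous (fun p : M × M => c p.1 p.2))
    (hcbdd : ∃ B : ℝ, ∀ x y, B ≤ c x y)
    (c₁ c₂ : M → ℝ) (hc₁ : Integrable c₁ μ) (hc₂ : Integrable c₂ ν)
    (hbound : ∀ x y, c x y ≤ c₁ x + c₂ y)
    -- C(μ,ν) < ∞ : some transport plan has finite cost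
    (hfin : ∃ Pl : Measure (M × M), Pl.map Prod.fst = μ ∧ Pl.map Prod.snd = ν ∧
      Integrable (fun p : M × M => c p.1 p.2) Pl) :
    ∃ f : M → EReal, (∀ x, f x ≠ ⊤) ∧ CConcave c f ∧ AttainsDualSup μ ν c f := by
  classical
  obtain ⟨B₀, hB₀⟩ := hcbdd
  obtain ⟨g, h, A, hA, B, hB, hg, hh, hgh, hmax⟩ := exists_ae_dual_maximizer hB₀ hc₁ hc₂ hbound
  obtain ⟨x₀, hx₀⟩ := Filter.nonempty_of_mem hA
  obtain ⟨y₀, hy₀⟩ := Filter.nonempty_of_mem hB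
  set H : M → EReal := fun y => if y ∈ B then (h y : EReal) else ⊥ with hH
  have hHB : ∀ y ∈ B, H y = (h y : EReal) := fun y hy => if_pos hy
  set f := c2Transform c H with hf
  have hgf : ∀ x ∈ A, (g x : EReal) ≤ f x := by
    intro x hx
    refine le_iInf fun y => ?_
    by_cases hy : y ∈ B
    · rw [hHB y hy, ← EReal.coe_sub, EReal.coe_le_coe_iff]
      linarith [hgh x hx y hy]
    · simp [hH, hy]
  have hHf : H ≤ c1Transform c f := le_c1Transform_iff.2 (le_c2Transform_iff.1 le_rfl)
  have hfup : ∀ x, f x ≤ ((c₁ x + c₂ y₀ - h y₀ : ℝ) : EReal) := fun x =>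
    iInf_coe_sub_le (i := y₀) (hHB y₀ hy₀).ge (hbound x y₀)
  have hf'up : ∀ y, c1Transform c f y ≤ ((c₁ x₀ + c₂ y - g x₀ : ℝ) : EReal) := fun y =>
    iInf_coe_sub_le (i := x₀) (hgf x₀ hx₀) (hbound x₀ y)
  have hftop : ∀ x, f x ≠ ⊤ := fun x => ne_top_of_le_ne_top (EReal.coe_ne_top _) (hfup x)
  have hf'top : ∀ y, c1Transform c f y ≠ ⊤ := fun y =>
    ne_top_of_le_ne_top (EReal.coe_ne_top _) (hf'up y)
  have hfmeas : Measurable f :=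
    measurable_iInf_coe_sub (φ := fun y x => c x y)
      (fun y => hccont.comp (continuous_id.prodMk continuous_const)) H
  have hf'meas : Measurable (c1Transform c f) :=
    measurable_iInf_coe_sub (φ := fun x y => c x y)
      (fun x => hccont.comp (continuous_const.prodMk continuous_id)) f
  obtain ⟨hfL, hfi⟩ := eRealL1_of_le_of_le hfmeas hg
    ((hc₁.add (integrable_const (c₂ y₀))).sub (integrable_const (h y₀)))
    (Filter.mem_of_superset hA hgf) hfup
  obtain ⟨hf'L, hf'i⟩ := eRealL1_of_le_of_le hf'meas hh
    (((integrable_const (c₁ x₀)).add hc₂).sub (integrable_const (g x₀)))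
    (Filter.mem_of_superset hB fun y hy => (hHB y hy).ge.trans (hHf y)) hf'up
  refine ⟨f, hftop, cConcave_c2Transform c H,
    ⟨hftop, hf'top, le_c1Transform_iff.1 le_rfl⟩, hfL, hf'L, fun g' h' hfeas hg' hh' => ?_⟩
  refine (hmax _ _ _ hg'.1 _ hh'.1 hg'.2 hh'.2 fun x hx y hy => ?_).trans (add_le_add hfi hf'i)
  have := hfeas.2.2 x y
  rw [← EReal.coe_toReal hx.2 hx.1, ← EReal.coe_toReal hy.2 hy.1] at this
  exact_mod_cast this
end
end

section
/- Let M be a Polish metric space, μ and ν Borel probability measures on M, and c : M×M → ℝ a continuous cost function bounded below. Assume there exist c₁ ∈ L¹(μ) and c₂ ∈ L¹(ν) with c(x,y) ≤ c₁(x) + c₂(y) for all (x,y), and that C(μ,ν) < ∞. Then: (i) the infimum C(μ,ν) is attained by some transport plan Π ∈ Γ(μ,ν); and (ii) if f : M → ℝ∪{−∞} is a c-concave function with f ∈ L¹(μ), f^{c₁} ∈ L¹(ν), such that (f, f^{c₁}) attains the supremum of the dual problem, then a plan Π ∈ Γ(μ,ν) attains the infimum C(μ,ν) if and only if Π is concentrated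 on the set {(x,y) ∈ M×M : f(x) + f^{c₁}(y) = c(x,y)}, i.e., Π assigns this set full measure. -/
open MeasureTheory Set
noncomputable section


/-- `Pl` is a transport plan between `μ` and `ν`. -/
def IsPlan {M : Type*} [MeasurableSpace M] (μ ν : Measure M)
    (Pl : Measure (M × M)) : Prop :=
  Pl.map Prod.fst = μ ∧ Pl.map Prod.snd = ν

/-- `Pl` attains the infimum `C(μ,ν) = inf_{Π ∈ Γ(μ,ν)} ∫ c dΠ` (the plans of
infinite cost, i.e. with non-integrable `c`, being excluded from the comparison
since `c` is bounded below). -/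
def AttainsMinPlan {M : Type*} [MeasurableSpace M] (μ ν : Measure M)
    (c : M → M → ℝ) (Pl : Measure (M × M)) : Prop :=
  IsPlan μ ν Pl ∧ Integrable (fun p : M × M => c p.1 p.2) Pl ∧
  ∀ Pl' : Measure (M × M), IsPlan μ ν Pl' →
    Integrable (fun p : M × M => c p.1 p.2) Pl' →
    (∫ p : M × M, c p.1 p.2 ∂Pl) ≤ ∫ p : M × M, c p.1 p.2 ∂Pl'

/-- For continuous `g ≥ 0`, the map `P ↦ ∫ g dP` is lower semicontinuous in the weak topology. -/
lemma lowerSemicontinuous_lintegral_probabilityMeasure {Ω : Type*} [TopologicalSpace Ω]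
    [MeasurableSpace Ω] [OpensMeasurableSpace Ω] {g : Ω → NNReal} (hg : Continuous g) :
    LowerSemicontinuous
      (fun P : ProbabilityMeasure Ω => ∫⁻ x, (g x : ENNReal) ∂(P : Measure Ω)) := by
  let t : ℕ → BoundedContinuousFunction Ω NNReal := fun n =>
    BoundedContinuousFunction.mkOfBound ⟨fun x => min (g x) n, by fun_prop⟩ n (by
      intro x y
      simp only [ContinuousMap.coe_mk, NNReal.dist_eq, NNReal.coe_min, NNReal.coe_natCast]
      have h1 : (0 : ℝ) ≤ min (g x : ℝ) n := by positivity
      have h2 : (0 : ℝ) ≤ min (g y : ℝ) n := by positivity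
      rw [abs_le]
      constructor <;> linarith [min_le_right (g x : ℝ) n, min_le_right (g y : ℝ) n])
  have key : (fun P : ProbabilityMeasure Ω => ∫⁻ x, (g x : ENNReal) ∂(P : Measure Ω)) =
      fun P : ProbabilityMeasure Ω => ⨆ n, ∫⁻ x, (t n x : ENNReal) ∂(P : Measure Ω) := by
    funext P
    rw [← lintegral_iSup]
    · congr with x
      apply le_antisymm
      · obtain ⟨n, hn⟩ := exists_nat_ge (g x)
        refine le_iSup_of_le n ?_
        simp [t, hn]
      · refine iSup_le fun n => ?_
        simp [t]
    · intro n
      exact (measurable_coe_nnreal_ennreal.comp (t n).continuous.measurable)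
    · intro m n hmn x
      simp only [t, BoundedContinuousFunction.mkOfBound_coe, ContinuousMap.coe_mk,
        ENNReal.coe_le_coe]
      gcongr
  rw [key]
  exact lowerSemicontinuous_iSup fun n =>
    (ProbabilityMeasure.continuous_lintegral_boundedContinuousFunction (t n)).lowerSemicontinuous

lemma IsPlan.isProbabilityMeasure {M : Type*} [MeasurableSpace M] {μ ν : Measure M}
    [IsProbabilityMeasure μ] {P : Measure (M × M)} (hP : IsPlan μ ν P) :
    IsProbabilityMeasure P := by
  constructor
  have h : P.map Prod.fst univ = 1 := by rw [hP.1]; exact measure_univ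
  rwa [Measure.map_apply measurable_fst MeasurableSet.univ, preimage_univ] at h

/-- The transport plans between two probability measures form a weakly compact set. -/
lemma isCompact_isPlan {M : Type*} [MetricSpace M] [CompleteSpace M]
    [SecondCountableTopology M] [MeasurableSpace M] [BorelSpace M]
    (μ ν : Measure M) [IsProbabilityMeasure μ] [IsProbabilityMeasure ν] :
    IsCompact {P : ProbabilityMeasure (M × M) | IsPlan μ ν P} := by
  let μ' : ProbabilityMeasure M := ⟨μ, inferInstance⟩
  let ν' : ProbabilityMeasure M := ⟨ν, inferInstance⟩
  have hclosed : IsClosed {P : ProbabilityMeasure (M × M) | IsPlan μ ν P} := by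
    have h : {P : ProbabilityMeasure (M × M) | IsPlan μ ν P} =
        {P | P.map measurable_fst.aemeasurable = μ'} ∩
          {P | P.map measurable_snd.aemeasurable = ν'} := by
      ext P
      refine and_congr ?_ ?_
      · exact (Subtype.ext_iff (a1 := P.map measurable_fst.aemeasurable) (a2 := μ')).symm
      · exact (Subtype.ext_iff (a1 := P.map measurable_snd.aemeasurable) (a2 := ν')).symm
    rw [h]
    exact (isClosed_eq (ProbabilityMeasure.continuous_map continuous_fst)
      continuous_const).inter
      (isClosed_eq (ProbabilityMeasure.continuous_map continuous_snd) continuous_const)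
  rw [← hclosed.closure_eq]
  apply isCompact_closure_of_isTightMeasureSet
  apply IsTightMeasureSet.prodMk
  · refine (isTightMeasureSet_singleton (μ := μ)).subset ?_
    rintro _ ⟨_, ⟨P, hP, rfl⟩, rfl⟩
    exact hP.1
  · refine (isTightMeasureSet_singleton (μ := ν)).subset ?_
    rintro _ ⟨_, ⟨P, hP, rfl⟩, rfl⟩
    exact hP.2

/-- Existence of optimal transport plans for continuous costs bounded below. -/
lemma exists_attainsMinPlan {M : Type*} [MetricSpace M] [CompleteSpace M]
    [SecondCountableTopology M] [MeasurableSpace M] [BorelSpace M]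
    (μ ν : Measure M) [IsProbabilityMeasure μ] [IsProbabilityMeasure ν]
    (c : M → M → ℝ) (hccont : Continuous (fun p : M × M => c p.1 p.2))
    {B : ℝ} (hB : ∀ x y, B ≤ c x y)
    (hfin : ∃ Pl : Measure (M × M), IsPlan μ ν Pl ∧
      Integrable (fun p : M × M => c p.1 p.2) Pl) :
    ∃ Pl : Measure (M × M), AttainsMinPlan μ ν c Pl := by
  let g : M × M → NNReal := fun p => Real.toNNReal (c p.1 p.2 - B)
  have hg : Continuous g := continuous_real_toNNReal.comp (hccont.sub continuous_const)
  have hgc : ∀ p : M × M, (g p : ENNReal) = ENNReal.ofReal (c p.1 p.2 - B) := fun p => rfl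
  obtain ⟨P₀, hP₀, hi₀⟩ := hfin
  have hpr₀ := hP₀.isProbabilityMeasure
  obtain ⟨P, hP, hmin⟩ := LowerSemicontinuousOn.exists_isMinOn
    (s := {P : ProbabilityMeasure (M × M) | IsPlan μ ν P}) ⟨⟨P₀, hpr₀⟩, hP₀⟩
    (isCompact_isPlan μ ν)
    ((lowerSemicontinuous_lintegral_probabilityMeasure hg).lowerSemicontinuousOn _)
  have hle : ∀ Q : Measure (M × M), IsPlan μ ν Q →
      ∫⁻ p, ENNReal.ofReal (c p.1 p.2 - B) ∂(P : Measure (M × M)) ≤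
        ∫⁻ p, ENNReal.ofReal (c p.1 p.2 - B) ∂Q := fun Q hQ =>
    hmin (show (⟨Q, hQ.isProbabilityMeasure⟩ : ProbabilityMeasure (M × M)) ∈ _ from hQ)
  have hnn : ∀ Q : Measure (M × M), 0 ≤ᵐ[Q] fun p : M × M => c p.1 p.2 - B := fun Q =>
    Filter.Eventually.of_forall fun p => sub_nonneg.2 (hB _ _)
  have hmeas : ∀ Q : Measure (M × M),
      AEStronglyMeasurable (fun p : M × M => c p.1 p.2 - B) Q := fun Q =>
    (hccont.sub continuous_const).aestronglyMeasurable
  have hfinite : ∀ Q : Measure (M × M), IsPlan μ ν Q →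
      Integrable (fun p : M × M => c p.1 p.2) Q →
      ∫⁻ p, ENNReal.ofReal (c p.1 p.2 - B) ∂Q ≠ ⊤ := by
    intro Q hQ hi
    have := hQ.isProbabilityMeasure
    have h := (hi.sub (integrable_const B)).lintegral_lt_top
    exact h.ne
  have hPi' : Integrable (fun p : M × M => c p.1 p.2 - B) (P : Measure (M × M)) :=
    ⟨hmeas _, (hasFiniteIntegral_iff_ofReal (hnn _)).2
      ((hle P₀ hP₀).trans_lt (hfinite P₀ hP₀ hi₀).lt_top)⟩
  have hPi : Integrable (fun p : M × M => c p.1 p.2) (P : Measure (M × M)) := by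
    exact (hPi'.add (integrable_const B)).congr (Filter.Eventually.of_forall fun p => by simp)
  refine ⟨P, hP, hPi, fun Q hQ hQi => ?_⟩
  have := hQ.isProbabilityMeasure
  have h : ∫ p, (c p.1 p.2 - B) ∂(P : Measure (M × M)) ≤ ∫ p, (c p.1 p.2 - B) ∂Q := by
    rw [integral_eq_lintegral_of_nonneg_ae (hnn _) (hmeas _),
      integral_eq_lintegral_of_nonneg_ae (hnn _) (hmeas _)]
    exact ENNReal.toReal_mono (hfinite Q hQ hQi) (hle Q hQ)
  rw [integral_sub hPi (integrable_const B), integral_sub hQi (integrable_const B)] at h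
  simpa using h

/-- An optimal plan cannot be improved by replacing a part `η` of it, up to scaling, with a
measure `θ` having the same marginals. -/
lemma AttainsMinPlan.integral_le_of_map_eq {M : Type*} [MeasurableSpace M] {μ ν : Measure M}
    [IsProbabilityMeasure μ] {c : M → M → ℝ} {P η θ : Measure (M × M)}
    (hP : AttainsMinPlan μ ν c P) [IsFiniteMeasure η] {K : ENNReal} (hK : K ≠ 0) (hK' : K ≠ ⊤)
    (hle : η ≤ K • P) (hfst : θ.map Prod.fst = η.map Prod.fst)
    (hsnd : θ.map Prod.snd = η.map Prod.snd)
    (hθ : Integrable (fun p : M × M => c p.1 p.2) θ) :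
    ∫ p, c p.1 p.2 ∂η ≤ ∫ p, c p.1 p.2 ∂θ := by
  obtain ⟨hplan, hint, hmin⟩ := hP
  have hadd : (K • P - η) + η = K • P := Measure.sub_add_cancel_of_le hle
  set R := K • P - η with hR
  have hKP : Integrable (fun p : M × M => c p.1 p.2) (K • P) := hint.smul_measure hK'
  have hRi : Integrable (fun p : M × M => c p.1 p.2) R := hKP.mono_measure Measure.sub_le
  have hηi : Integrable (fun p : M × M => c p.1 p.2) η := hKP.mono_measure hle
  have hmap : ∀ (π : M × M → M), Measurable π → θ.map π = η.map π →
      (K⁻¹ • (R + θ)).map π = P.map π := by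
    intro π hπ h
    rw [Measure.map_smul, Measure.map_add _ _ hπ, h, ← Measure.map_add _ _ hπ, hadd,
      Measure.map_smul, smul_smul, ENNReal.inv_mul_cancel hK hK', one_smul]
  have hle' := hmin (K⁻¹ • (R + θ))
    ⟨(hmap _ measurable_fst hfst).trans hplan.1, (hmap _ measurable_snd hsnd).trans hplan.2⟩
    ((hRi.add_measure hθ).smul_measure (ENNReal.inv_ne_top.2 hK))
  have hPeq : P = K⁻¹ • (R + η) := by
    rw [hadd, smul_smul, ENNReal.inv_mul_cancel hK hK', one_smul]
  rw [hPeq, integral_smul_measure, integral_smul_measure, integral_add_measure hRi hηi,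
    integral_add_measure hRi hθ] at hle'
  have hpos : 0 < (K⁻¹).toReal :=
    ENNReal.toReal_pos (ENNReal.inv_ne_zero.2 hK') (ENNReal.inv_ne_top.2 hK)
  have := le_of_mul_le_mul_left hle' hpos
  linarith

/-- The support of an optimal plan is `c`-cyclically monotone. -/
lemma AttainsMinPlan.sum_le_sum_perm {M : Type*} [MetricSpace M]
    [SecondCountableTopology M] [MeasurableSpace M] [BorelSpace M] {μ ν : Measure M}
    [IsProbabilityMeasure μ] {c : M → M → ℝ}
    (hccont : Continuous (fun p : M × M => c p.1 p.2)) {P : Measure (M × M)}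
    (hP : AttainsMinPlan μ ν c P) {ι : Type*} [Fintype ι] (σ : Equiv.Perm ι)
    (z : ι → M × M) (hz : ∀ i, z i ∈ P.support) :
    ∑ i, c (z i).1 (z i).2 ≤ ∑ i, c (z (σ i)).1 (z i).2 := by
  cases isEmpty_or_nonempty ι
  · simp
  have := hP.1.isProbabilityMeasure
  suffices h : ∀ ε > 0, ∑ i, (c (z i).1 (z i).2 - ε) ≤ ∑ i, (c (z (σ i)).1 (z i).2 + ε) by
    have hlim : Filter.Tendsto (fun ε : ℝ => ∑ i, (c (z (σ i)).1 (z i).2 + ε) -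
        ∑ i, (c (z i).1 (z i).2 - ε)) (nhdsWithin 0 (Ioi 0))
        (nhds (∑ i, (c (z (σ i)).1 (z i).2 + 0) - ∑ i, (c (z i).1 (z i).2 - 0))) :=
      (Continuous.tendsto (by fun_prop) 0).mono_left nhdsWithin_le_nhds
    have h0 := ge_of_tendsto hlim (b := 0)
      (Filter.eventually_of_mem self_mem_nhdsWithin fun ε hε => sub_nonneg.2 (h ε hε))
    simpa using h0
  intro ε hε
  have hnear : ∀ q : M × M, ∀ᶠ δ in nhdsWithin (0 : ℝ) (Ioi 0),
      ∀ p ∈ Metric.ball q δ, |c p.1 p.2 - c q.1 q.2| < ε := by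
    intro q
    obtain ⟨δ, hδ, h⟩ := Metric.continuous_iff.1 hccont q ε hε
    filter_upwards [Ioo_mem_nhdsGT hδ] with r hr p hp
    exact h p ((Metric.mem_ball.1 hp).trans hr.2)
  obtain ⟨δ, ⟨hδ1, hδ2⟩, (hδ : 0 < δ)⟩ := (((Filter.eventually_all.2 fun i => hnear (z i)).and
    (Filter.eventually_all.2 fun i => hnear ((z (σ i)).1, (z i).2))).and
    self_mem_nhdsWithin).exists
  let A : ι → Set (M × M) := fun i => Metric.ball (z i) δ
  have hAm : ∀ i, MeasurableSet (A i) := fun i => Metric.isOpen_ball.measurableSet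
  have hA0 : ∀ i, P (A i) ≠ 0 := fun i =>
    (Measure.mem_support_iff_forall _).1 (hz i) _ (Metric.ball_mem_nhds _ hδ) |>.ne'
  let η : ι → Measure (M × M) := fun i => (P (A i))⁻¹ • P.restrict (A i)
  have hηp : ∀ i, IsProbabilityMeasure (η i) := fun i =>
    ProbabilityTheory.cond_isProbabilityMeasure (hA0 i)
  let θ : ι → Measure (M × M) := fun i => ((η (σ i)).map Prod.fst).prod ((η i).map Prod.snd)
  have hfp : ∀ i, IsProbabilityMeasure ((η i).map Prod.fst) := fun i =>
    Measure.isProbabilityMeasure_map measurable_fst.aemeasurable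
  have hsp : ∀ i, IsProbabilityMeasure ((η i).map Prod.snd) := fun i =>
    Measure.isProbabilityMeasure_map measurable_snd.aemeasurable
  have hηA : ∀ i, ∀ᵐ p ∂(η i), p ∈ A i := fun i =>
    Measure.ae_smul_measure (ae_restrict_mem (hAm i)) _
  have hθA : ∀ i, ∀ᵐ p ∂(θ i), p ∈ Metric.ball ((z (σ i)).1, (z i).2) δ := by
    intro i
    have h1 : ∀ᵐ x ∂((η (σ i)).map Prod.fst), x ∈ Metric.ball (z (σ i)).1 δ := by
      refine (ae_map_iff measurable_fst.aemeasurable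
        (Metric.isOpen_ball (x := (z (σ i)).1) (ε := δ)).measurableSet).2 ?_
      filter_upwards [hηA (σ i)] with p hp
      exact (max_lt_iff.1 (Metric.mem_ball.1 hp)).1
    have h2 : ∀ᵐ y ∂((η i).map Prod.snd), y ∈ Metric.ball (z i).2 δ := by
      refine (ae_map_iff measurable_snd.aemeasurable
        (Metric.isOpen_ball (x := (z i).2) (ε := δ)).measurableSet).2 ?_
      filter_upwards [hηA i] with p hp
      exact (max_lt_iff.1 (Metric.mem_ball.1 hp)).2
    filter_upwards [Measure.quasiMeasurePreserving_fst.ae h1,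
      Measure.quasiMeasurePreserving_snd.ae h2] with p hp1 hp2
    exact max_lt (Metric.mem_ball.1 hp1) (Metric.mem_ball.1 hp2)
  have hintegrable : ∀ (Q : Measure (M × M)) [IsProbabilityMeasure Q] (q : M × M),
      (∀ᵐ p ∂Q, |c p.1 p.2 - c q.1 q.2| < ε) → Integrable (fun p : M × M => c p.1 p.2) Q := by
    intro Q _ q h
    refine Integrable.of_bound hccont.aestronglyMeasurable (|c q.1 q.2| + ε) ?_
    filter_upwards [h] with p hp
    rw [Real.norm_eq_abs]
    linarith [abs_sub_abs_le_abs_sub (c p.1 p.2) (c q.1 q.2)]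
  have hηc : ∀ i, ∀ᵐ p ∂(η i), |c p.1 p.2 - c (z i).1 (z i).2| < ε := fun i =>
    (hηA i).mono (hδ1 i)
  have hθc : ∀ i, ∀ᵐ p ∂(θ i), |c p.1 p.2 - c (z (σ i)).1 (z i).2| < ε := fun i =>
    (hθA i).mono (hδ2 i)
  have hηi : ∀ i, Integrable (fun p : M × M => c p.1 p.2) (η i) := fun i =>
    hintegrable _ _ (hηc i)
  have hθi : ∀ i, Integrable (fun p : M × M => c p.1 p.2) (θ i) := fun i =>
    hintegrable _ ((z (σ i)).1, (z i).2) (hθc i)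
  have hmain := hP.integral_le_of_map_eq (η := ∑ i, η i) (θ := ∑ i, θ i)
    (K := ∑ i, (P (A i))⁻¹)
    (by simp [Finset.sum_eq_zero_iff])
    (by simp [ENNReal.sum_eq_top, hA0])
    (by
      rw [Finset.sum_smul]
      refine Finset.sum_le_sum fun i _ => ?_
      intro s
      simp only [η, Measure.smul_apply, smul_eq_mul]
      gcongr
      exact Measure.restrict_le_self)
    (by
      rw [Measure.map_finset_sum measurable_fst.aemeasurable,
        Measure.map_finset_sum measurable_fst.aemeasurable]
      simp only [θ, Measure.map_fst_prod, measure_univ, one_smul]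
      exact Equiv.sum_comp σ fun i => (η i).map Prod.fst)
    (by
      rw [Measure.map_finset_sum measurable_snd.aemeasurable,
        Measure.map_finset_sum measurable_snd.aemeasurable]
      simp only [θ, Measure.map_snd_prod, measure_univ, one_smul])
    (integrable_finsetSum_measure.2 fun i _ => hθi i)
  rw [integral_finsetSum_measure fun i _ => hηi i,
    integral_finsetSum_measure fun i _ => hθi i] at hmain
  refine (Finset.sum_le_sum fun i _ => ?_).trans (hmain.trans (Finset.sum_le_sum fun i _ => ?_))
  · have h := integral_mono_ae (integrable_const (c (z i).1 (z i).2 - ε)) (hηi i)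
      ((hηc i).mono fun p hp => by linarith [(abs_lt.1 hp).1])
    simpa using h
  · have h := integral_mono_ae (hθi i) (integrable_const (c (z (σ i)).1 (z i).2 + ε))
      ((hθc i).mono fun p hp => by linarith [(abs_lt.1 hp).2])
    simpa using h

/-- A point chain in `S` of length `n + 1` issued from `z₀`. -/
def ChainFrom {X : Type*} (S : Set (X × X)) (z₀ : X × X) : Type _ :=
  {s : ℕ × (ℕ → X × X) // s.2 0 = z₀ ∧ ∀ i, s.2 i ∈ S}

/-- The cost increment along a chain ending at the point `x`. -/
def chainCost {X : Type*} (c : X → X → ℝ) (n : ℕ) (z : ℕ → X × X) (x : X) : ℝ :=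
  (∑ i ∈ Finset.range n, (c (z (i + 1)).1 (z i).2 - c (z i).1 (z i).2)) +
    (c x (z n).2 - c (z n).1 (z n).2)

/-- Rockafellar's potential of a set `S` based at `z₀`. -/
def rockafellarPotential {X : Type*} (c : X → X → ℝ) (S : Set (X × X)) (z₀ : X × X) :
    X → EReal :=
  fun x => ⨅ s : ChainFrom S z₀, (chainCost c s.1.1 s.1.2 x : EReal)

/-- `c`-cyclical monotonicity of a set. -/
def CCyclicallyMonotone {X : Type*} (c : X → X → ℝ) (S : Set (X × X)) : Prop :=
  ∀ (n : ℕ) (σ : Equiv.Perm (Fin n)) (z : Fin n → X × X), (∀ i, z i ∈ S) →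
    ∑ i, c (z i).1 (z i).2 ≤ ∑ i, c (z (σ i)).1 (z i).2

lemma rockafellarPotential_le {X : Type*} (c : X → X → ℝ) {S : Set (X × X)} {z₀ : X × X}
    (hz₀ : z₀ ∈ S) (x : X) :
    rockafellarPotential c S z₀ x ≤ ((c x z₀.2 - c z₀.1 z₀.2 : ℝ) : EReal) := by
  refine (iInf_le _ (⟨(0, fun _ => z₀), rfl, fun _ => hz₀⟩ : ChainFrom S z₀)).trans ?_
  simp [chainCost]

lemma CCyclicallyMonotone.chainCost_nonneg {X : Type*} {c : X → X → ℝ} {S : Set (X × X)}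
    (hS : CCyclicallyMonotone c S) (n : ℕ) (z : ℕ → X × X) (hz : ∀ i, z i ∈ S) :
    0 ≤ chainCost c n z (z 0).1 := by
  have h := hS (n + 1) (finRotate (n + 1)) (fun i => z i) fun i => hz i
  rw [Fin.sum_univ_castSucc, Fin.sum_univ_castSucc] at h
  have hrot : ∀ i : Fin n, ((finRotate (n + 1) i.castSucc : Fin (n + 1)) : ℕ) = i + 1 := by
    intro i
    exact congrArg Fin.val (finRotate_of_lt i.2)
  simp only [hrot, finRotate_last, Fin.val_castSucc, Fin.val_last, Fin.val_zero] at h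
  rw [Fin.sum_univ_eq_sum_range (fun i => c (z i).1 (z i).2),
    Fin.sum_univ_eq_sum_range (fun i => c (z (i + 1)).1 (z i).2)] at h
  rw [chainCost, Finset.sum_sub_distrib]
  linarith

lemma rockafellarPotential_le_add {X : Type*} (c : X → X → ℝ) {S : Set (X × X)} {z₀ p : X × X}
    (hp : p ∈ S) (x : X) (s : ChainFrom S z₀) :
    rockafellarPotential c S z₀ x ≤
      ((chainCost c s.1.1 s.1.2 p.1 + (c x p.2 - c p.1 p.2) : ℝ) : EReal) := by
  obtain ⟨⟨n, z⟩, h0, hz⟩ := s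
  refine (iInf_le _ (⟨(n + 1, fun i => if i ≤ n then z i else p), by simpa using h0, fun i => by
    dsimp only
    split_ifs
    exacts [hz i, hp]⟩ : ChainFrom S z₀)).trans ?_
  rw [EReal.coe_le_coe_iff]
  apply le_of_eq
  simp only [chainCost, Finset.sum_range_succ]
  have h : ∀ i ∈ Finset.range n,
      c (if i + 1 ≤ n then z (i + 1) else p).1 (if i ≤ n then z i else p).2 -
        c (if i ≤ n then z i else p).1 (if i ≤ n then z i else p).2 =
      c (z (i + 1)).1 (z i).2 - c (z i).1 (z i).2 := by
    intro i hi
    have hi := Finset.mem_range.1 hi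
    rw [if_pos (by omega), if_pos (by omega)]
  rw [Finset.sum_congr rfl h]
  simp

/-- On a `c`-cyclically monotone set, Rockafellar's potential grows at most like `c`. -/
lemma rockafellarPotential_le_add_sub {X : Type*} (c : X → X → ℝ) {S : Set (X × X)}
    {z₀ p : X × X} (hp : p ∈ S) (x : X) :
    rockafellarPotential c S z₀ x - ((c x p.2 - c p.1 p.2 : ℝ) : EReal) ≤
      rockafellarPotential c S z₀ p.1 := by
  refine le_iInf fun s => ?_
  rw [EReal.sub_le_iff_le_add (by simp) (by simp)]
  exact_mod_cast rockafellarPotential_le_add c hp x s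

lemma CCyclicallyMonotone.rockafellarPotential_base {X : Type*} {c : X → X → ℝ}
    {S : Set (X × X)} (hS : CCyclicallyMonotone c S) {z₀ : X × X} (hz₀ : z₀ ∈ S) :
    rockafellarPotential c S z₀ z₀.1 = 0 := by
  apply le_antisymm
  · simpa using rockafellarPotential_le c hz₀ z₀.1
  · refine le_iInf fun ⟨⟨n, z⟩, h0, hz⟩ => ?_
    have h := hS.chainCost_nonneg n z hz
    have h0 : z 0 = z₀ := h0
    rw [h0] at h
    exact_mod_cast h

lemma CCyclicallyMonotone.rockafellarPotential_ne_bot {X : Type*} {c : X → X → ℝ}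
    {S : Set (X × X)} (hS : CCyclicallyMonotone c S) {z₀ p : X × X} (hz₀ : z₀ ∈ S)
    (hp : p ∈ S) : rockafellarPotential c S z₀ p.1 ≠ ⊥ := by
  have h := rockafellarPotential_le_add_sub (z₀ := z₀) c hp z₀.1
  rw [hS.rockafellarPotential_base hz₀] at h
  intro hbot
  rw [hbot, le_bot_iff] at h
  have h' : ((0 - (c z₀.1 p.2 - c p.1 p.2) : ℝ) : EReal) = ⊥ := by
    rw [EReal.coe_sub]; exact h
  exact EReal.coe_ne_bot _ h'

lemma rockafellarPotential_ne_top {X : Type*} (c : X → X → ℝ) {S : Set (X × X)} {z₀ : X × X}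
    (hz₀ : z₀ ∈ S) (x : X) : rockafellarPotential c S z₀ x ≠ ⊤ :=
  ne_top_of_le_ne_top (EReal.coe_ne_top _) (rockafellarPotential_le c hz₀ x)

lemma add_c1Transform_le {X : Type*} (c : X → X → ℝ) {g : X → EReal} (hg : ∀ x, g x ≠ ⊤)
    (x y : X) : g x + c1Transform c g y ≤ (c x y : EReal) := by
  have h : c1Transform c g y ≤ (c x y : EReal) - g x := iInf_le _ x
  induction hgx : g x with
  | bot => simp
  | top => exact absurd hgx (hg x)
  | coe a =>
    rw [hgx] at h
    calc (a : EReal) + c1Transform c g y ≤ a + ((c x y : EReal) - a) := by gcongr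
      _ = (c x y : EReal) := by
        rw [← EReal.coe_sub, ← EReal.coe_add]; simp

/-- Rockafellar's potential and its transform are in contact with `c` on `S`. -/
lemma CCyclicallyMonotone.rockafellarPotential_add_c1Transform {X : Type*} {c : X → X → ℝ}
    {S : Set (X × X)} (hS : CCyclicallyMonotone c S) {z₀ p : X × X} (hz₀ : z₀ ∈ S)
    (hp : p ∈ S) :
    rockafellarPotential c S z₀ p.1 + c1Transform c (rockafellarPotential c S z₀) p.2 =
      (c p.1 p.2 : EReal) := by
  apply le_antisymm (add_c1Transform_le c (rockafellarPotential_ne_top c hz₀) _ _)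
  obtain ⟨a, ha⟩ : ∃ a : ℝ, (a : EReal) = rockafellarPotential c S z₀ p.1 :=
    ⟨_, EReal.coe_toReal (rockafellarPotential_ne_top c hz₀ _)
      (hS.rockafellarPotential_ne_bot hz₀ hp)⟩
  have h : ((c p.1 p.2 - a : ℝ) : EReal) ≤
      c1Transform c (rockafellarPotential c S z₀) p.2 := by
    refine le_iInf fun x => ?_
    have hx := rockafellarPotential_le_add_sub (z₀ := z₀) c hp x
    rw [← ha] at hx
    have hxt := rockafellarPotential_ne_top c hz₀ x
    induction hv : rockafellarPotential c S z₀ x with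
    | bot => simp
    | top => exact absurd hv hxt
    | coe b =>
      rw [hv, ← EReal.coe_sub, EReal.coe_le_coe_iff] at hx
      rw [← EReal.coe_sub, EReal.coe_le_coe_iff]
      linarith
  calc (c p.1 p.2 : EReal) = (a : EReal) + ((c p.1 p.2 - a : ℝ) : EReal) := by
        rw [← EReal.coe_add]; simp
    _ ≤ _ := by rw [ha]; gcongr

lemma upperSemicontinuous_rockafellarPotential {X : Type*} [TopologicalSpace X] {c : X → X → ℝ}
    (hc : Continuous fun p : X × X => c p.1 p.2) (S : Set (X × X)) (z₀ : X × X) :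
    UpperSemicontinuous (rockafellarPotential c S z₀) := by
  refine upperSemicontinuous_iInf fun s => Continuous.upperSemicontinuous ?_
  refine continuous_coe_real_ereal.comp ?_
  have h : ∀ y, Continuous fun x => c x y := fun y =>
    hc.comp (continuous_id.prodMk continuous_const)
  unfold chainCost
  exact continuous_const.add ((h _).sub continuous_const)

lemma upperSemicontinuous_c1Transform {X : Type*} [TopologicalSpace X] {c : X → X → ℝ}
    (hc : Continuous fun p : X × X => c p.1 p.2) {g : X → EReal} (hg : ∀ x, g x ≠ ⊤) :
    UpperSemicontinuous (c1Transform c g) := by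
  refine upperSemicontinuous_iInf fun x => Continuous.upperSemicontinuous ?_
  induction hgx : g x with
  | bot => simpa using continuous_const
  | top => exact absurd hgx (hg x)
  | coe a =>
    have h : Continuous fun y => c x y := hc.comp (continuous_const.prodMk continuous_id)
    simp_rw [← EReal.coe_sub]
    exact continuous_coe_real_ereal.comp (h.sub continuous_const)

lemma IsPlan.measurePreserving_fst {M : Type*} [MeasurableSpace M] {μ ν : Measure M}
    {P : Measure (M × M)} (hP : IsPlan μ ν P) : MeasurePreserving Prod.fst P μ :=
  ⟨measurable_fst, hP.1⟩

lemma IsPlan.measurePreserving_snd {M : Type*} [MeasurableSpace M] {μ ν : Measure M}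
    {P : Measure (M × M)} (hP : IsPlan μ ν P) : MeasurePreserving Prod.snd P ν :=
  ⟨measurable_snd, hP.2⟩

lemma IsPlan.ae_coe_toReal {M : Type*} [MeasurableSpace M] {μ ν : Measure M}
    {P : Measure (M × M)} (hP : IsPlan μ ν P) {g h : M → EReal} (hg : ERealL1 μ g)
    (hh : ERealL1 ν h) :
    ∀ᵐ p ∂P, g p.1 + h p.2 = (((g p.1).toReal + (h p.2).toReal : ℝ) : EReal) := by
  filter_upwards [hP.measurePreserving_fst.quasiMeasurePreserving.ae hg.1,
    hP.measurePreserving_snd.quasiMeasurePreserving.ae hh.1] with p h1 h2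
  rw [EReal.coe_add, EReal.coe_toReal h1.2 h1.1, EReal.coe_toReal h2.2 h2.1]

lemma IsPlan.integrable_toReal_add {M : Type*} [MeasurableSpace M] {μ ν : Measure M}
    {P : Measure (M × M)} (hP : IsPlan μ ν P) {g h : M → EReal} (hg : ERealL1 μ g)
    (hh : ERealL1 ν h) :
    Integrable (fun p : M × M => (g p.1).toReal + (h p.2).toReal) P :=
  (hP.measurePreserving_fst.integrable_comp_of_integrable hg.2).add
    (hP.measurePreserving_snd.integrable_comp_of_integrable hh.2)

lemma IsPlan.integral_toReal_add {M : Type*} [MeasurableSpace M] {μ ν : Measure M}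
    {P : Measure (M × M)} (hP : IsPlan μ ν P) {g h : M → EReal} (hg : ERealL1 μ g)
    (hh : ERealL1 ν h) :
    ∫ p, ((g p.1).toReal + (h p.2).toReal) ∂P = dualValue μ ν g h := by
  refine (integral_add (hP.measurePreserving_fst.integrable_comp_of_integrable hg.2)
    (hP.measurePreserving_snd.integrable_comp_of_integrable hh.2)).trans ?_
  rw [dualValue]
  congr 1
  · have h1 := hP.1
    subst h1
    exact (integral_map measurable_fst.aemeasurable hg.2.aestronglyMeasurable).symm
  · have h2 := hP.2
    subst h2
    exact (integral_map measurable_snd.aemeasurable hh.2.aestronglyMeasurable).symm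

lemma IsPlan.ae_toReal_add_le {M : Type*} [MeasurableSpace M] {μ ν : Measure M}
    {P : Measure (M × M)} (hP : IsPlan μ ν P) {c : M → M → ℝ} {g h : M → EReal}
    (hgh : DualFeasible c g h) (hg : ERealL1 μ g) (hh : ERealL1 ν h) :
    ∀ᵐ p ∂P, (g p.1).toReal + (h p.2).toReal ≤ c p.1 p.2 := by
  filter_upwards [hP.ae_coe_toReal hg hh] with p hp
  have := hgh.2.2 p.1 p.2
  rwa [hp, EReal.coe_le_coe_iff] at this

/-- Weak duality. -/
lemma IsPlan.dualValue_le_integral {M : Type*} [MeasurableSpace M] {μ ν : Measure M}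
    {P : Measure (M × M)} (hP : IsPlan μ ν P) {c : M → M → ℝ}
    (hc : Integrable (fun p : M × M => c p.1 p.2) P) {g h : M → EReal}
    (hgh : DualFeasible c g h) (hg : ERealL1 μ g) (hh : ERealL1 ν h) :
    dualValue μ ν g h ≤ ∫ p, c p.1 p.2 ∂P := by
  rw [← hP.integral_toReal_add hg hh]
  exact integral_mono_ae (hP.integrable_toReal_add hg hh) hc (hP.ae_toReal_add_le hgh hg hh)

/-- If `u(x) + v(y)` is bounded below along a plan, with `u` and `v` bounded above by integrable
functions, then `u` is integrable for the first marginal. -/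
lemma MeasureTheory.MeasurePreserving.integrable_of_le_of_le_add {X Y Z : Type*}
    [MeasurableSpace X] [MeasurableSpace Y] [MeasurableSpace Z] {P : Measure Z}
    [IsFiniteMeasure P] {μ : Measure X} {ν : Measure Y} {π₁ : Z → X} {π₂ : Z → Y}
    (h₁ : MeasurePreserving π₁ P μ) (h₂ : MeasurePreserving π₂ P ν) {u a : X → ℝ} {v b : Y → ℝ}
    (hu : Measurable u) (ha : Integrable a μ) (hb : Integrable b ν)
    (hua : ∀ᵐ p ∂P, u (π₁ p) ≤ a (π₁ p)) (hvb : ∀ᵐ p ∂P, v (π₂ p) ≤ b (π₂ p)) {B : ℝ}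
    (hB : ∀ᵐ p ∂P, B ≤ u (π₁ p) + v (π₂ p)) : Integrable u μ := by
  rw [← h₁.integrable_comp hu.aestronglyMeasurable]
  refine (((h₁.integrable_comp_of_integrable ha).norm.add
    (h₂.integrable_comp_of_integrable hb).norm).add (integrable_const |B|)).mono'
    (hu.comp h₁.measurable).aestronglyMeasurable ?_
  filter_upwards [hua, hvb, hB] with p h1 h2 h3
  simp only [Pi.add_apply, Function.comp_apply, Real.norm_eq_abs]
  rw [abs_le]
  constructor
  · linarith [neg_abs_le B, abs_nonneg (a (π₁ p)), le_abs_self (b (π₂ p))]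
  · linarith [abs_nonneg B, le_abs_self (a (π₁ p)), abs_nonneg (b (π₂ p))]

/-- Strong duality: the cost of an optimal plan is attained in the dual problem. -/
lemma AttainsMinPlan.exists_dualFeasible {M : Type*} [MetricSpace M]
    [SecondCountableTopology M] [MeasurableSpace M] [BorelSpace M] {μ ν : Measure M}
    [IsProbabilityMeasure μ] [IsProbabilityMeasure ν] {c : M → M → ℝ}
    (hccont : Continuous (fun p : M × M => c p.1 p.2)) {B : ℝ} (hB : ∀ x y, B ≤ c x y)
    {c₁ c₂ : M → ℝ} (hc₁ : Integrable c₁ μ) (hc₂ : Integrable c₂ ν)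
    (hbound : ∀ x y, c x y ≤ c₁ x + c₂ y) {P : Measure (M × M)}
    (hP : AttainsMinPlan μ ν c P) :
    ∃ g h : M → EReal, DualFeasible c g h ∧ ERealL1 μ g ∧ ERealL1 ν h ∧
      dualValue μ ν g h = ∫ p, c p.1 p.2 ∂P := by
  have hpr := hP.1.isProbabilityMeasure
  have hS : CCyclicallyMonotone c P.support := fun n σ z hz => hP.sum_le_sum_perm hccont σ z hz
  obtain ⟨z₀, hz₀⟩ : P.support.Nonempty := Measure.nonempty_support hpr.ne_zero
  set g := rockafellarPotential c P.support z₀ with hg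
  set h := c1Transform c g with hh
  have hgtop : ∀ x, g x ≠ ⊤ := rockafellarPotential_ne_top c hz₀
  have hsum : ∀ x y, g x + h y ≤ (c x y : EReal) := add_c1Transform_le c hgtop
  have hhle : ∀ y, h y ≤ (c z₀.1 y : EReal) := by
    intro y
    have := hsum z₀.1 y
    rwa [hg, hS.rockafellarPotential_base hz₀, zero_add] at this
  have hhtop : ∀ y, h y ≠ ⊤ := fun y => ne_top_of_le_ne_top (EReal.coe_ne_top _) (hhle y)
  have hgm : Measurable g := (upperSemicontinuous_rockafellarPotential hccont _ _).measurable
  have hhm : Measurable h := (upperSemicontinuous_c1Transform hccont hgtop).measurable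
  have hcontact : ∀ p ∈ P.support, g p.1 + h p.2 = (c p.1 p.2 : EReal) := fun p hp =>
    hS.rockafellarPotential_add_c1Transform hz₀ hp
  have hbot : ∀ p ∈ P.support, g p.1 ≠ ⊥ ∧ h p.2 ≠ ⊥ := by
    intro p hp
    have := hcontact p hp
    constructor <;> intro hb <;> simp [hb] at this
  have hsupp : ∀ᵐ p ∂P, p ∈ P.support := Measure.support_mem_ae
  have hreal : ∀ᵐ p ∂P, (g p.1).toReal + (h p.2).toReal = c p.1 p.2 := by
    filter_upwards [hsupp] with p hp
    have := hcontact p hp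
    rwa [← EReal.coe_toReal (hgtop p.1) (hbot p hp).1,
      ← EReal.coe_toReal (hhtop p.2) (hbot p hp).2, ← EReal.coe_add, EReal.coe_eq_coe_iff] at this
  have hga : ∀ᵐ p ∂P, (g p.1).toReal ≤ c₁ p.1 + (c₂ z₀.2 - c z₀.1 z₀.2) := by
    filter_upwards [hsupp] with p hp
    have := rockafellarPotential_le c hz₀ p.1
    rw [← hg, ← EReal.coe_toReal (hgtop p.1) (hbot p hp).1, EReal.coe_le_coe_iff] at this
    linarith [hbound p.1 z₀.2]
  have hhb : ∀ᵐ p ∂P, (h p.2).toReal ≤ c₁ z₀.1 + c₂ p.2 := by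
    filter_upwards [hsupp] with p hp
    have := hhle p.2
    rw [← EReal.coe_toReal (hhtop p.2) (hbot p hp).2, EReal.coe_le_coe_iff] at this
    linarith [hbound z₀.1 p.2]
  have hf := hP.1.measurePreserving_fst
  have hs := hP.1.measurePreserving_snd
  have ha := hc₁.add (integrable_const (μ := μ) (c₂ z₀.2 - c z₀.1 z₀.2))
  have hb := (integrable_const (μ := ν) (c₁ z₀.1)).add hc₂
  have hgL : ERealL1 μ g := by
    constructor
    · rw [← hP.1.1]
      refine (ae_map_iff measurable_fst.aemeasurable
        (((hgm (measurableSet_singleton ⊥)).compl).inter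
          ((hgm (measurableSet_singleton ⊤)).compl))).2 ?_
      filter_upwards [hsupp] with p hp
      exact ⟨(hbot p hp).1, hgtop p.1⟩
    · exact hf.integrable_of_le_of_le_add (v := fun y => (h y).toReal) hs hgm.ereal_toReal
        ha hb hga hhb
        (hreal.mono fun p hp => (hB p.1 p.2).trans hp.ge)
  have hhL : ERealL1 ν h := by
    constructor
    · rw [← hP.1.2]
      refine (ae_map_iff measurable_snd.aemeasurable
        (((hhm (measurableSet_singleton ⊥)).compl).inter
          ((hhm (measurableSet_singleton ⊤)).compl))).2 ?_
      filter_upwards [hsupp] with p hp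
      exact ⟨(hbot p hp).2, hhtop p.2⟩
    · exact hs.integrable_of_le_of_le_add (v := fun x => (g x).toReal) hf hhm.ereal_toReal
        hb ha hhb hga
        (hreal.mono fun p hp => (hB p.1 p.2).trans (hp.ge.trans (add_comm _ _).le))
  refine ⟨g, h, ⟨hgtop, hhtop, hsum⟩, hgL, hhL, ?_⟩
  rw [← hP.1.integral_toReal_add hgL hhL]
  exact integral_congr_ae hreal

/-- **Existence of optimal plans, and characterization of optimal plans by
concentration on the contact set of a dual maximizer.** -/
theorem optimal_plan_exists_and_characterization
    {M : Type*} [MetricSpace M] [CompleteSpace M] [TopologicalSpace.SeparableSpace M]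
    [MeasurableSpace M] [BorelSpace M]
    (μ ν : Measure M) [IsProbabilityMeasure μ] [IsProbabilityMeasure ν]
    (c : M → M → ℝ) (hccont : Continuous (fun p : M × M => c p.1 p.2))
    (hcbdd : ∃ B : ℝ, ∀ x y, B ≤ c x y)
    (c₁ c₂ : M → ℝ) (hc₁ : Integrable c₁ μ) (hc₂ : Integrable c₂ ν)
    (hbound : ∀ x y, c x y ≤ c₁ x + c₂ y)
    (hfin : ∃ Pl : Measure (M × M), IsPlan μ ν Pl ∧
      Integrable (fun p : M × M => c p.1 p.2) Pl) :
    -- (i) the infimum C(μ,ν) is attained by some transport plan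
    (∃ Pl : Measure (M × M), AttainsMinPlan μ ν c Pl) ∧
    -- (ii) given a c-concave dual maximizer f, a plan is optimal iff it is
    -- concentrated on {(x,y) : f(x) + f^{c₁}(y) = c(x,y)}
    ∀ f : M → EReal, (∀ x, f x ≠ ⊤) → CConcave c f → AttainsDualSup μ ν c f →
      ∀ Pl : Measure (M × M), IsPlan μ ν Pl →
        (AttainsMinPlan μ ν c Pl ↔
          Pl {p : M × M | f p.1 + c1Transform c f p.2 = (c p.1 p.2 : EReal)}ᶜ = 0) := by
  have : SecondCountableTopology M := UniformSpace.secondCountable_of_separable M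
  obtain ⟨B, hB⟩ := hcbdd
  refine ⟨exists_attainsMinPlan μ ν c hccont hB hfin, fun f _ _ hdual Pl hPl => ?_⟩
  obtain ⟨hfeas, hf, hfc, hsup⟩ := hdual
  have hcontact : (∀ᵐ p ∂Pl, (f p.1).toReal + (c1Transform c f p.2).toReal = c p.1 p.2) ↔
      Pl {p : M × M | f p.1 + c1Transform c f p.2 = (c p.1 p.2 : EReal)}ᶜ = 0 := by
    change _ ↔ ∀ᵐ p ∂Pl, f p.1 + c1Transform c f p.2 = (c p.1 p.2 : EReal)
    apply Filter.eventually_congr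
    filter_upwards [hPl.ae_coe_toReal hf hfc] with p hp
    rw [hp, EReal.coe_eq_coe_iff]
  rw [← hcontact]
  have hint := hPl.integrable_toReal_add hf hfc
  constructor
  · intro hmin
    obtain ⟨g, h, hgh, hg, hh, hval⟩ :=
      hmin.exists_dualFeasible hccont hB hc₁ hc₂ hbound
    have hle : ∫ p, c p.1 p.2 ∂Pl ≤
        ∫ p, ((f p.1).toReal + (c1Transform c f p.2).toReal) ∂Pl := by
      rw [← hval, hPl.integral_toReal_add hf hfc]
      exact hsup g h hgh hg hh
    have hae := hPl.ae_toReal_add_le hfeas hf hfc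
    exact (integral_eq_iff_of_ae_le hint hmin.2.1 hae).1
      (le_antisymm (integral_mono_ae hint hmin.2.1 hae) hle)
  · intro hae
    refine ⟨hPl, hint.congr hae, fun Q hQ hQi => ?_⟩
    rw [← integral_congr_ae hae, hPl.integral_toReal_add hf hfc]
    exact hQ.dualValue_le_integral hQi hfeas hf hfc
end
end

section
/- Let M be a metric space, c : M×M → ℝ a continuous function, f, g : M → ℝ real-valued upper semicontinuous functions with f(x) + g(y) ≤ c(x,y) for all (x,y) ∈ M×M, φ : M → M a continuous map, and S ⊆ M a set such that f(x) + g(φ(x)) = c(x,φ(x)) for every x ∈ S. Then the restriction of f to S is continuous. -/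
open MeasureTheory Set
noncomputable section

/-- **If real-valued upper semicontinuous functions `f, g` satisfy
`f(x) + g(y) ≤ c(x,y)` everywhere with equality along a continuous map `φ` on a set
`S`, then the restriction of `f` to `S` is continuous.** -/
theorem restriction_continuous_of_contact_on_set
    {M : Type*} [MetricSpace M]
    (c : M → M → ℝ) (hccont : Continuous (fun p : M × M => c p.1 p.2))
    (f g : M → ℝ) (hfu : UpperSemicontinuous f) (hgu : UpperSemicontinuous g)
    (hle : ∀ x y, f x + g y ≤ c x y)
    (φ : M → M) (hφ : Continuous φ)
    (S : Set M) (heq : ∀ x ∈ S, f x + g (φ x) = c x (φ x)) :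
    ContinuousOn f S := by
  intro x hx
  refine tendsto_order.2 ⟨fun a ha => ?_, fun a ha => (hfu x a ha).filter_mono nhdsWithin_le_nhds⟩
  have hc : Continuous fun x => c x (φ x) := hccont.comp (continuous_id.prodMk hφ)
  have hcx : ∀ᶠ y in nhds x, c x (φ x) - (f x - a) / 2 < c y (φ y) :=
    hc.continuousAt.eventually_const_lt (by linarith)
  have hgx : ∀ᶠ y in nhds x, g (φ y) < g (φ x) + (f x - a) / 2 :=
    hφ.continuousAt.eventually (hgu (φ x) _ (by linarith))
  filter_upwards [nhdsWithin_le_nhds hcx, nhdsWithin_le_nhds hgx, self_mem_nhdsWithin]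
    with y hcy hgy hy
  linarith [heq x hx, heq y hy]
end
end

section
/- The function f : (−π, π) → ℝ defined by f(b) = (2b − sin(2b))/(4 sin²(b)) for b ≠ 0 and f(0) = 0 is continuous and strictly increasing on (−π, π); moreover f(b) → +∞ as b → π⁻ and f(b) → −∞ as b → −π⁺, so f is a bijection from (−π, π) onto ℝ and in particular is invertible. -/
open Real Filter
noncomputable section

/-- The function `(2b − sin 2b)/(4 sin² b)`, extended by `0` at `b = 0`. -/
def grushinFun (b : ℝ) : ℝ :=
  if b = 0 then 0 else (2 * b - Real.sin (2 * b)) / (4 * Real.sin b ^ 2)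

/-- Division by zero makes the case distinction in `grushinFun` superfluous. -/
lemma grushinFun_eq (b : ℝ) :
    grushinFun b = (2 * b - Real.sin (2 * b)) / (4 * Real.sin b ^ 2) := by
  unfold grushinFun
  split_ifs with h <;> simp [h]

@[simp]
lemma grushinFun_zero : grushinFun 0 = 0 := by simp [grushinFun]

@[simp]
lemma grushinFun_neg (b : ℝ) : grushinFun (-b) = -grushinFun b := by
  simp only [grushinFun_eq, mul_neg, Real.sin_neg, neg_sq, ← neg_div]
  ring

lemma Real.mul_cos_lt_sin_of_mem_Ioo {b : ℝ} (h0 : 0 < b) (hpi : b < π) :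
    b * Real.cos b < Real.sin b := by
  rcases lt_or_ge b (π / 2) with h | h
  · have hc : 0 < Real.cos b := Real.cos_pos_of_mem_Ioo ⟨by linarith, h⟩
    have ht := Real.lt_tan h0 h
    rwa [Real.tan_eq_sin_div_cos, lt_div_iff₀ hc] at ht
  · have hc : Real.cos b ≤ 0 := Real.cos_nonpos_of_pi_div_two_le_of_le h (by linarith)
    exact (mul_nonpos_of_nonneg_of_nonpos h0.le hc).trans_lt (Real.sin_pos_of_pos_of_lt_pi h0 hpi)

lemma hasDerivAt_grushinFun {b : ℝ} (hs : Real.sin b ≠ 0) :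
    HasDerivAt grushinFun ((Real.sin b - b * Real.cos b) / Real.sin b ^ 3) b := by
  have hnum : HasDerivAt (fun x : ℝ => 2 * x - Real.sin (2 * x))
      (2 * 1 - Real.cos (2 * b) * (2 * 1)) b :=
    ((hasDerivAt_id b).const_mul 2).sub ((hasDerivAt_id b).const_mul 2).sin
  have hden : HasDerivAt (fun x : ℝ => 4 * Real.sin x ^ 2)
      (4 * (2 * Real.sin b * Real.cos b)) b := by
    simpa using ((Real.hasDerivAt_sin b).pow 2).const_mul 4
  rw [funext grushinFun_eq]
  refine (hnum.div hden (by positivity)).congr_deriv ?_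
  rw [Real.sin_two_mul, Real.cos_two_mul, Real.cos_sq']
  field_simp
  linear_combination (4 * Real.sin b) * Real.sin_sq_add_cos_sq b

lemma abs_grushinFun_le {b : ℝ} (hb : |b| ≤ 1 / 2) : |grushinFun b| ≤ 2 * |b| := by
  wlog h0 : 0 ≤ b generalizing b
  · simpa using this (b := -b) (by simpa using hb) (by linarith)
  rcases h0.eq_or_lt with rfl | hpos
  · simp
  rw [abs_of_pos hpos] at hb ⊢
  have h2 : 2 * b - (2 * b) ^ 3 / 6 < Real.sin (2 * b) :=
    Real.sin_gt_sub_cube (by linarith)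
  have h1 : b - b ^ 3 / 6 < Real.sin b := Real.sin_gt_sub_cube hpos
  have hlt : Real.sin (2 * b) < 2 * b := Real.sin_lt (by linarith)
  have hs : b / 2 ≤ Real.sin b := by nlinarith [mul_pos hpos hpos]
  have hs2 : b ^ 2 ≤ 4 * Real.sin b ^ 2 := by nlinarith
  have hb2 : 0 < 4 * Real.sin b ^ 2 := by nlinarith
  rw [grushinFun_eq, abs_of_nonneg (div_nonneg (by linarith) hb2.le), div_le_iff₀ hb2]
  nlinarith [mul_le_mul_of_nonneg_left hs2 hpos.le]

lemma continuousAt_grushinFun_zero : ContinuousAt grushinFun 0 := by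
  rw [ContinuousAt, grushinFun_zero]
  have hlim : Tendsto (fun b : ℝ => 2 * |b|) (nhds 0) (nhds 0) :=
    Continuous.tendsto' (by fun_prop) _ _ (by simp)
  refine squeeze_zero_norm' ?_ hlim
  filter_upwards [Metric.closedBall_mem_nhds (0 : ℝ) (by norm_num : (0 : ℝ) < 1 / 2)] with b hb
  exact abs_grushinFun_le (by simpa using hb)

lemma continuousOn_grushinFun : ContinuousOn grushinFun (Set.Ioo (-π) π) := by
  intro b hb
  rcases eq_or_ne b 0 with rfl | h0
  · exact continuousAt_grushinFun_zero.continuousWithinAt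
  · have hs : Real.sin b ≠ 0 := fun h => h0 ((Real.sin_eq_zero_iff_of_lt_of_lt hb.1 hb.2).1 h)
    exact (hasDerivAt_grushinFun hs).continuousAt.continuousWithinAt

lemma strictMonoOn_grushinFun : StrictMonoOn grushinFun (Set.Ioo (-π) π) := by
  have hright : StrictMonoOn grushinFun (Set.Ico 0 π) := by
    refine strictMonoOn_of_deriv_pos (convex_Ico 0 π)
      (continuousOn_grushinFun.mono fun b hb => ⟨by linarith [hb.1, Real.pi_pos], hb.2⟩) ?_
    rw [interior_Ico]
    intro b hb
    have hs := Real.sin_pos_of_pos_of_lt_pi hb.1 hb.2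
    rw [(hasDerivAt_grushinFun hs.ne').deriv]
    exact div_pos (sub_pos.2 (Real.mul_cos_lt_sin_of_mem_Ioo hb.1 hb.2)) (pow_pos hs 3)
  have hleft : StrictMonoOn grushinFun (Set.Ioc (-π) 0) := by
    intro x hx y hy hxy
    have := hright (a := -y) (b := -x) ⟨by linarith [hy.2], by linarith [hy.1]⟩
      ⟨by linarith [hx.2], by linarith [hx.1]⟩ (by linarith)
    simpa using this
  have hunion := hleft.union hright (isGreatest_Ioc (neg_lt_zero.2 Real.pi_pos))
    (isLeast_Ico Real.pi_pos)
  rwa [Set.Ioc_union_Ico_eq_Ioo (neg_lt_zero.2 Real.pi_pos) Real.pi_pos] at hunion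

lemma tendsto_grushinFun_pi : Tendsto grushinFun (nhdsWithin π (Set.Iio π)) atTop := by
  have hnum : Tendsto (fun b : ℝ => 2 * b - Real.sin (2 * b)) (nhdsWithin π (Set.Iio π))
      (nhds (2 * π)) :=
    (Continuous.tendsto' (by fun_prop) _ _ (by simp)).mono_left nhdsWithin_le_nhds
  have hden : Tendsto (fun b : ℝ => 4 * Real.sin b ^ 2) (nhdsWithin π (Set.Iio π))
      (nhdsWithin 0 (Set.Ioi 0)) := by
    refine tendsto_nhdsWithin_iff.2
      ⟨(Continuous.tendsto' (by fun_prop) _ _ (by simp)).mono_left nhdsWithin_le_nhds, ?_⟩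
    filter_upwards [Ioo_mem_nhdsLT Real.pi_pos] with b hb
    have := Real.sin_pos_of_pos_of_lt_pi hb.1 hb.2
    exact Set.mem_Ioi.2 (by positivity)
  rw [funext grushinFun_eq]
  exact hnum.pos_mul_atTop Real.two_pi_pos hden.inv_tendsto_nhdsGT_zero

lemma tendsto_grushinFun_neg_pi :
    Tendsto grushinFun (nhdsWithin (-π) (Set.Ioi (-π))) atBot := by
  have h := tendsto_neg_atTop_atBot.comp (tendsto_grushinFun_pi.comp tendsto_neg_nhdsGT_neg)
  exact h.congr fun b => by simp

lemma bijOn_grushinFun : Set.BijOn grushinFun (Set.Ioo (-π) π) Set.univ := by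
  have hpi : -π < π := by linarith [Real.pi_pos]
  refine ⟨Set.mapsTo_univ _ _, strictMonoOn_grushinFun.injOn, ?_⟩
  exact continuousOn_grushinFun.surjOn_of_tendsto (Set.nonempty_Ioo.2 hpi)
    ((tendsto_comp_coe_Ioo_atBot hpi).2 tendsto_grushinFun_neg_pi)
    ((tendsto_comp_coe_Ioo_atTop hpi).2 tendsto_grushinFun_pi)

/-- **The function `f(b) = (2b − sin 2b)/(4 sin² b)` (with `f(0) = 0`) is a continuous,
strictly increasing bijection from `(−π, π)` onto `ℝ`, tending to `+∞` at `π⁻` and to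
`−∞` at `(−π)⁺`; in particular it is invertible.** -/
theorem grushin_f_strictMono_bijective :
    let f : ℝ → ℝ := fun b =>
      if b = 0 then 0 else (2 * b - Real.sin (2 * b)) / (4 * Real.sin b ^ 2)
    ContinuousOn f (Set.Ioo (-π) π) ∧
    StrictMonoOn f (Set.Ioo (-π) π) ∧
    Tendsto f (nhdsWithin π (Set.Iio π)) atTop ∧
    Tendsto f (nhdsWithin (-π) (Set.Ioi (-π))) atBot ∧
    Set.BijOn f (Set.Ioo (-π) π) Set.univ :=
  ⟨continuousOn_grushinFun, strictMonoOn_grushinFun, tendsto_grushinFun_pi,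
    tendsto_grushinFun_neg_pi, bijOn_grushinFun⟩
end
end

section
/- Fix real numbers a, δ and b with 0 < |b| ≤ π. The curve γ : [0,1] → ℝ², γ(t) = ((a/b)·sin(bt), (a²/(4b²))·(2bt − sin(2bt)) + δ), is an admissible curve of the Grushin plane (with controls u₁(t) = a·cos(bt), u₂(t) = b) of length |a|, and it is length-minimizing: every admissible curve of the Grushin plane defined on [0,1] joining the point (0, δ) to the point γ(1) has length at least |a|. -/
open MeasureTheory Set Real
noncomputable section

/-- `u₁, u₂` are measurable bounded controls representing the Lipschitz curve `γ` as an
admissible curve of the Grushin plane: `γ̇₁ = u₁`, `γ̇₂ = u₂·γ₁` a.e. on `[0,1]`. -/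
def GrushinControls (γ : ℝ → ℝ × ℝ) (u₁ u₂ : ℝ → ℝ) : Prop :=
  Measurable u₁ ∧ Measurable u₂ ∧
  Bornology.IsBounded (u₁ '' Icc 0 1) ∧ Bornology.IsBounded (u₂ '' Icc 0 1) ∧
  ∀ᵐ t ∂(volume.restrict (Icc (0:ℝ) 1)),
    HasDerivAt (fun s => (γ s).1) (u₁ t) t ∧
    HasDerivAt (fun s => (γ s).2) (u₂ t * (γ t).1) t

/-- An admissible curve of the Grushin plane on `[0,1]`. -/
def GrushinAdmissible (γ : ℝ → ℝ × ℝ) : Prop :=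
  (∃ K : NNReal, LipschitzOnWith K γ (Icc 0 1)) ∧ ∃ u₁ u₂, GrushinControls γ u₁ u₂

/-- The length of an admissible curve of the Grushin plane: the infimum over all
representing controls of `∫₀¹ √(u₁² + u₂²) dt`. -/
def grushinLength (γ : ℝ → ℝ × ℝ) : ℝ :=
  sInf {r : ℝ | ∃ u₁ u₂, GrushinControls γ u₁ u₂ ∧
    (∫ t in (0:ℝ)..1, Real.sqrt (u₁ t ^ 2 + u₂ t ^ 2)) = r}

open Filter Topology in
/-- Postcomposing an absolutely continuous function with a Lipschitz one. -/
theorem AbsolutelyContinuousOnInterval.lipschitzOnWith_comp {f g : ℝ → ℝ} {p q : ℝ} {s : Set ℝ}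
    {K : NNReal} (hg : LipschitzOnWith K g s) (hf : AbsolutelyContinuousOnInterval f p q)
    (hfs : MapsTo f (uIcc p q) s) : AbsolutelyContinuousOnInterval (fun t => g (f t)) p q := by
  rw [absolutelyContinuousOnInterval_iff] at hf ⊢
  intro ε hε
  obtain ⟨d, hd, H⟩ := hf (ε / (K + 1)) (by positivity)
  refine ⟨d, hd, fun E hE hEd => ?_⟩
  have hlt := H E hE hEd
  rw [lt_div_iff₀ (by positivity)] at hlt
  have hle : ∑ i ∈ Finset.range E.1, dist (g (f (E.2 i).1)) (g (f (E.2 i).2)) ≤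
      K * ∑ i ∈ Finset.range E.1, dist (f (E.2 i).1) (f (E.2 i).2) := by
    rw [Finset.mul_sum]
    exact Finset.sum_le_sum fun i hi =>
      hg.dist_le_mul _ (hfs (hE.1 i hi).1) _ (hfs (hE.1 i hi).2)
  have hnn : 0 ≤ ∑ i ∈ Finset.range E.1, dist (f (E.2 i).1) (f (E.2 i).2) :=
    Finset.sum_nonneg fun _ _ => dist_nonneg
  linarith

/-- The pointwise calibration inequality behind `calibration_bound`. -/
theorem calibration_deriv_le {c x u v W M s k : ℝ} (hc : 0 ≤ c) (hM : 0 < M) (hs : 0 < s)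
    (hsk : s ^ 2 + k ^ 2 = 1) (hW : √(u ^ 2 + v ^ 2) ≤ W) :
    2 * c * (v * x) + c * (2 * x * u * (k / s) + x ^ 2 * (-(c * (W / M)) / s ^ 2)) ≤ M * W := by
  have hW0 : 0 ≤ W := (Real.sqrt_nonneg _).trans hW
  have huv : u ^ 2 + v ^ 2 ≤ W ^ 2 := (Real.sqrt_le_left hW0).1 hW
  obtain ⟨p, rfl⟩ : ∃ p, x = p * s := ⟨x / s, by field_simp⟩
  have hq : |v * s + u * k| ≤ W :=
    abs_le_of_sq_le_sq (by nlinarith [sq_nonneg (v * k - u * s)]) hW0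
  have hpq : p * (v * s + u * k) ≤ |p| * W :=
    (le_abs_self _).trans (by rw [abs_mul]; gcongr)
  have hsq : 0 ≤ W / M * (c * |p| - M) ^ 2 := by positivity
  have hexp : W / M * (c * |p| - M) ^ 2 = c ^ 2 * p ^ 2 * (W / M) - 2 * c * (|p| * W) + M * W := by
    rw [← sq_abs p]; field_simp; ring
  have hL : 2 * c * (v * (p * s)) +
      c * (2 * (p * s) * u * (k / s) + (p * s) ^ 2 * (-(c * (W / M)) / s ^ 2)) =
      2 * c * (p * (v * s + u * k)) - c ^ 2 * p ^ 2 * (W / M) := by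
    field_simp; ring
  rw [hL]
  nlinarith [mul_le_mul_of_nonneg_left hpq hc]

/-- Calibrating with `2 c y + c x² cot θ`, where the angle `θ` runs from `ε` to `c + ε`
proportionally to the integral of an upper bound `W` for the speed. -/
theorem calibration_bound {x y u v W : ℝ → ℝ} {c ε : ℝ} (hc : 0 ≤ c) (hε : 0 < ε) (hcε : c + ε < π)
    (hx : AbsolutelyContinuousOnInterval x 0 1) (hy : AbsolutelyContinuousOnInterval y 0 1)
    (hx0 : x 0 = 0)
    (hxy : ∀ᵐ t, t ∈ Icc (0 : ℝ) 1 → HasDerivAt x (u t) t ∧ HasDerivAt y (v t * x t) t)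
    (hW : ∀ t, √(u t ^ 2 + v t ^ 2) ≤ W t) (hWi : IntervalIntegrable W volume 0 1)
    (hM : 0 < ∫ t in (0 : ℝ)..1, W t) :
    2 * c * (y 1 - y 0) + c * (x 1 ^ 2 * (cos (c + ε) / sin (c + ε))) ≤
      (∫ t in (0 : ℝ)..1, W t) ^ 2 := by
  set M := ∫ t in (0 : ℝ)..1, W t with hMdef
  have hW0 : ∀ t, 0 ≤ W t := fun t => (Real.sqrt_nonneg _).trans (hW t)
  set l : ℝ → ℝ := fun t => ∫ s in (0 : ℝ)..t, W s with hl
  have hl1 : l 1 = M := rfl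
  have hlAC : AbsolutelyContinuousOnInterval l 0 1 :=
    hWi.absolutelyContinuousOnInterval_intervalIntegral (by simp)
  have hlmem : ∀ t ∈ Icc (0 : ℝ) 1, l t ∈ Icc 0 M := fun t ht =>
    ⟨intervalIntegral.integral_nonneg ht.1 fun s _ => hW0 s,
      intervalIntegral.integral_mono_interval le_rfl ht.1 ht.2
        (Filter.Eventually.of_forall hW0) hWi⟩
  set θ : ℝ → ℝ := fun s => c * (s / M) + ε with hθ
  have hsin : ∀ s ∈ Icc 0 M, 0 < sin (θ s) := by
    intro s hs
    have h1 : s / M ≤ 1 := (div_le_one hM).2 hs.2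
    have h0 : 0 ≤ s / M := div_nonneg hs.1 hM.le
    exact sin_pos_of_pos_of_lt_pi (by simp only [hθ]; positivity)
      (by simp only [hθ]; nlinarith)
  set g : ℝ → ℝ := fun s => cos (θ s) / sin (θ s) with hg
  have hgC : ContDiffOn ℝ 1 g (Icc 0 M) := by
    have hθC : ContDiff ℝ 1 θ := by fun_prop
    exact (contDiff_cos.comp hθC).contDiffOn.div (contDiff_sin.comp hθC).contDiffOn
      fun s hs => (hsin s hs).ne'
  obtain ⟨K, hK⟩ := hgC.exists_lipschitzOnWith (by decide) (convex_Icc _ _) isCompact_Icc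
  have hglAC : AbsolutelyContinuousOnInterval (fun t => g (l t)) 0 1 :=
    hlAC.lipschitzOnWith_comp hK (by rw [uIcc_of_le zero_le_one]; exact hlmem)
  have hgd : ∀ s ∈ Icc 0 M, HasDerivAt g (-(c / M) / sin (θ s) ^ 2) s := by
    intro s hs
    have hθd : HasDerivAt θ (c / M) s := by
      simpa [hθ, div_eq_mul_inv] using (((hasDerivAt_id s).div_const M).const_mul c).add_const ε
    have h := hθd.cos.div hθd.sin (hsin s hs).ne'
    convert! h using 1
    congr 1
    linear_combination (-(c / M)) * (sin_sq_add_cos_sq (θ s)).symm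
  set F : ℝ → ℝ := fun t => 2 * c * y t + c * (x t ^ 2 * g (l t)) with hF
  have hFAC : AbsolutelyContinuousOnInterval F 0 1 := by
    have h := (hy.const_mul (2 * c)).add (((hx.mul hx).mul hglAC).const_mul c)
    convert! h using 1
    ext t
    simp [hF, sq]
  have hFd : ∀ᵐ t, t ∈ Icc (0 : ℝ) 1 → deriv F t ≤ M * W t := by
    filter_upwards [hxy, hWi.ae_hasDerivAt_integral] with t ht htl htI
    obtain ⟨hxt, hyt⟩ := ht htI
    have hlt : HasDerivAt l (W t) t :=
      htl (by rwa [uIcc_of_le zero_le_one]) 0 (by simp)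
    have hglt := (hgd (l t) (hlmem t htI)).comp t hlt
    have hFt := (hyt.const_mul (2 * c)).add (((hxt.pow 2).mul hglt).const_mul c)
    have hle := calibration_deriv_le (x := x t) hc hM (hsin (l t) (hlmem t htI))
      (sin_sq_add_cos_sq (θ (l t))) (hW t)
    refine le_trans (le_of_eq ?_) hle
    refine HasDerivAt.deriv ?_
    convert! hFt using 1
    simp only [hg, Function.comp_apply, Pi.pow_apply]
    push_cast
    ring
  have hint : ∫ t in (0 : ℝ)..1, deriv F t ≤ ∫ t in (0 : ℝ)..1, M * W t :=
    intervalIntegral.integral_mono_ae_restrict zero_le_one hFAC.intervalIntegrable_deriv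
      (hWi.const_mul M) ((ae_restrict_iff' measurableSet_Icc).2 hFd)
  rw [hFAC.integral_deriv_eq_sub, intervalIntegral.integral_const_mul, ← hMdef] at hint
  have hθ1 : θ M = c + ε := by simp [hθ, hM.ne']
  simp only [hF, hl1, hx0, hg, hθ1] at hint
  linarith

open Filter Topology in
/-- The sharp lower bound, obtained by letting `c → b` and `ε → 0` in `calibration_bound`. -/
theorem sharp_bound {x y u v W : ℝ → ℝ} {a b : ℝ} (hb : 0 < b) (hbπ : b ≤ π)
    (hx : AbsolutelyContinuousOnInterval x 0 1) (hy : AbsolutelyContinuousOnInterval y 0 1)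
    (hx0 : x 0 = 0) (hx1 : x 1 = a / b * sin b)
    (hy1 : y 1 - y 0 = a ^ 2 / (4 * b ^ 2) * (2 * b - sin (2 * b)))
    (hxy : ∀ᵐ t, t ∈ Icc (0 : ℝ) 1 → HasDerivAt x (u t) t ∧ HasDerivAt y (v t * x t) t)
    (hW : ∀ t, √(u t ^ 2 + v t ^ 2) ≤ W t) (hWi : IntervalIntegrable W volume 0 1)
    (hM : 0 < ∫ t in (0 : ℝ)..1, W t) :
    |a| ≤ ∫ t in (0 : ℝ)..1, W t := by
  set Φ : ℝ → ℝ := fun ε => 2 * (b - 2 * ε) * (y 1 - y 0) +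
    (b - 2 * ε) * (x 1 ^ 2 * (cos (b - 2 * ε + ε) / sin (b - 2 * ε + ε))) with hΦ
  have hΦ0 : Φ 0 = a ^ 2 := by
    simp only [hΦ, hx1, hy1, sin_two_mul, mul_zero, sub_zero, add_zero]
    rcases eq_or_ne (sin b) 0 with h | h
    · simp only [h]; field_simp; ring
    · field_simp; ring
  have hcont : ContinuousAt Φ 0 := by
    rcases eq_or_ne (sin b) 0 with h | h
    · simp only [hΦ, hx1, h, mul_zero, ne_eq, OfNat.ofNat_ne_zero, not_false_eq_true, zero_pow,
        zero_mul, add_zero]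
      fun_prop
    · simp only [hΦ]
      have : sin (b - 2 * 0 + 0) ≠ 0 := by simpa using h
      fun_prop (disch := assumption)
  have hlim : Tendsto Φ (𝓝[>] 0) (𝓝 (a ^ 2)) := by
    rw [← hΦ0]; exact hcont.tendsto.mono_left nhdsWithin_le_nhds
  have hsq : a ^ 2 ≤ (∫ t in (0 : ℝ)..1, W t) ^ 2 := by
    refine le_of_tendsto hlim ?_
    filter_upwards [Ioo_mem_nhdsGT (half_pos hb)] with ε hε
    exact calibration_bound (by linarith [hε.2]) hε.1 (by linarith [hε.1]) hx hy hx0 hxy hW hWi hM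
  exact abs_le_of_sq_le_sq hsq hM.le

/-- Every choice of controls for a curve with the endpoints of the geodesic costs at least `|a|`. -/
theorem GrushinControls.abs_le_integral {γ : ℝ → ℝ × ℝ} {u v : ℝ → ℝ} {a b δ : ℝ} {K : NNReal}
    (hK : LipschitzOnWith K γ (Icc 0 1)) (h : GrushinControls γ u v)
    (hb : 0 < |b|) (hbπ : |b| ≤ π) (h0 : γ 0 = (0, δ))
    (h1 : γ 1 = (a / b * sin b, a ^ 2 / (4 * b ^ 2) * (2 * b - sin (2 * b)) + δ)) :
    |a| ≤ ∫ t in (0 : ℝ)..1, √(u t ^ 2 + v t ^ 2) := by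
  obtain ⟨hum, hvm, hub, hvb, hd⟩ := h
  have hint : IntervalIntegrable (fun t => √(u t ^ 2 + v t ^ 2)) volume 0 1 := by
    obtain ⟨C, hC⟩ := hub.exists_norm_le
    obtain ⟨D, hD⟩ := hvb.exists_norm_le
    rw [intervalIntegrable_iff_integrableOn_Icc_of_le zero_le_one]
    refine Measure.integrableOn_of_bounded (M := √(C ^ 2 + D ^ 2)) (by simp)
      (by fun_prop) ?_
    refine (ae_restrict_iff' measurableSet_Icc).2 (Filter.Eventually.of_forall fun t ht => ?_)
    rw [Real.norm_of_nonneg (Real.sqrt_nonneg _)]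
    refine Real.sqrt_le_sqrt (add_le_add ?_ ?_)
    · exact sq_le_sq' (abs_le.1 (hC _ ⟨t, ht, rfl⟩)).1 (abs_le.1 (hC _ ⟨t, ht, rfl⟩)).2
    · exact sq_le_sq' (abs_le.1 (hD _ ⟨t, ht, rfl⟩)).1 (abs_le.1 (hD _ ⟨t, ht, rfl⟩)).2
  have hx : AbsolutelyContinuousOnInterval (fun t => (γ t).1) 0 1 := by
    refine LipschitzOnWith.absolutelyContinuousOnInterval (K := 1 * K) ?_
    rw [uIcc_of_le zero_le_one]
    exact LipschitzWith.prod_fst.comp_lipschitzOnWith hK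
  have hy : AbsolutelyContinuousOnInterval (fun t => (γ t).2) 0 1 := by
    refine LipschitzOnWith.absolutelyContinuousOnInterval (K := 1 * K) ?_
    rw [uIcc_of_le zero_le_one]
    exact LipschitzWith.prod_snd.comp_lipschitzOnWith hK
  have hd := (ae_restrict_iff' measurableSet_Icc).1 hd
  refine le_of_forall_pos_le_add fun η hη => ?_
  have hWint : ∫ t in (0 : ℝ)..1, (√(u t ^ 2 + v t ^ 2) + η) =
      (∫ t in (0 : ℝ)..1, √(u t ^ 2 + v t ^ 2)) + η := by
    rw [intervalIntegral.integral_add hint (by simp)]; simp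
  have hWi : IntervalIntegrable (fun t => √(u t ^ 2 + v t ^ 2) + η) volume 0 1 :=
    hint.add (by simp)
  have hM : 0 < ∫ t in (0 : ℝ)..1, (√(u t ^ 2 + v t ^ 2) + η) := by
    rw [hWint]
    have := intervalIntegral.integral_nonneg (μ := volume) (zero_le_one (α := ℝ))
      fun t _ => Real.sqrt_nonneg (u t ^ 2 + v t ^ 2)
    linarith
  rw [← hWint]
  rcases lt_or_gt_of_ne (abs_pos.1 hb) with hneg | hpos
  · rw [abs_of_neg hneg] at hb hbπ
    refine sharp_bound (u := u) (v := fun t => -v t) hb hbπ hx hy.neg (by simp [h0]) ?_ ?_ ?_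
      (fun t => by simpa using hη.le) hWi hM
    · simp [h1, div_neg]
    · simp [h0, h1]; ring
    · filter_upwards [hd] with t ht htI
      exact ⟨(ht htI).1, by simpa using (ht htI).2.neg⟩
  · rw [abs_of_pos hpos] at hbπ
    exact sharp_bound hpos hbπ hx hy (by simp [h0]) (by simp [h1]) (by simp [h0, h1]) hd
      (fun t => by simpa using hη.le) hWi hM

/-- The controls `a cos (b t)`, `a sin (b t)` drive the Grushin geodesic. -/
theorem grushinControls_geodesic (a δ : ℝ) {b : ℝ} (hb : b ≠ 0) :
    GrushinControls (fun t => (a / b * sin (b * t),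
      a ^ 2 / (4 * b ^ 2) * (2 * b * t - sin (2 * b * t)) + δ))
      (fun t => a * cos (b * t)) (fun t => a * sin (b * t)) := by
  refine ⟨by fun_prop, by fun_prop,
    (isCompact_Icc.image (by fun_prop)).isBounded, (isCompact_Icc.image (by fun_prop)).isBounded,
    Filter.Eventually.of_forall fun t => ⟨?_, ?_⟩⟩
  · have h := (((hasDerivAt_id t).const_mul b).sin).const_mul (a / b)
    convert! h using 1
    simp
    field_simp
  · have h2 := (hasDerivAt_id t).const_mul (2 * b)
    have h := ((h2.sub h2.sin).const_mul (a ^ 2 / (4 * b ^ 2))).add_const δ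
    convert! h using 1
    simp only [id, mul_one, mul_assoc 2 b t, cos_two_mul, cos_sq']
    field_simp
    ring

/-- **The Grushin geodesic `γ(t) = ((a/b) sin(bt), (a²/(4b²))(2bt − sin(2bt)) + δ)`,
for `0 < |b| ≤ π`, is an admissible curve of length `|a|`, and it is length-minimizing
among admissible curves joining `(0, δ)` to `γ(1)`.** -/
theorem grushin_geodesic_minimizing (a δ b : ℝ) (hb : 0 < |b|) (hbπ : |b| ≤ π) :
    let γ : ℝ → ℝ × ℝ := fun t =>
      ((a / b) * Real.sin (b * t),
        (a ^ 2 / (4 * b ^ 2)) * (2 * b * t - Real.sin (2 * b * t)) + δ)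
    GrushinAdmissible γ ∧ grushinLength γ = |a| ∧
    ∀ γ' : ℝ → ℝ × ℝ, GrushinAdmissible γ' → γ' 0 = (0, δ) → γ' 1 = γ 1 →
      |a| ≤ grushinLength γ' := by
  intro γ
  have hmin : ∀ γ' : ℝ → ℝ × ℝ, GrushinAdmissible γ' → γ' 0 = (0, δ) → γ' 1 = γ 1 →
      ∀ r ∈ {r : ℝ | ∃ u₁ u₂, GrushinControls γ' u₁ u₂ ∧
        (∫ t in (0:ℝ)..1, Real.sqrt (u₁ t ^ 2 + u₂ t ^ 2)) = r}, |a| ≤ r := by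
    rintro γ' ⟨⟨K, hK⟩, -⟩ h0 h1 r ⟨u, v, huv, rfl⟩
    exact huv.abs_le_integral hK hb hbπ h0 (by simpa [γ] using h1)
  have hctrl : GrushinControls γ (fun t => a * cos (b * t)) (fun t => a * sin (b * t)) :=
    grushinControls_geodesic a δ (abs_pos.1 hb)
  have hadm : GrushinAdmissible γ := by
    refine ⟨?_, _, _, hctrl⟩
    have hγ : ContDiff ℝ 1 γ := by fun_prop
    exact hγ.contDiffOn.exists_lipschitzOnWith (by decide) (convex_Icc _ _) isCompact_Icc
  have hγmin := hmin γ hadm (by simp [γ]) rfl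
  have hlen : (∫ t in (0:ℝ)..1, √((a * cos (b * t)) ^ 2 + (a * sin (b * t)) ^ 2)) = |a| := by
    have : ∀ t, √((a * cos (b * t)) ^ 2 + (a * sin (b * t)) ^ 2) = |a| := fun t => by
      rw [mul_pow, mul_pow, ← mul_add, cos_sq_add_sin_sq, mul_one, sqrt_sq_eq_abs]
    simp [this]
  refine ⟨hadm, le_antisymm ?_ ?_, fun γ' hγ' h0 h1 => ?_⟩
  · exact csInf_le ⟨|a|, hγmin⟩ ⟨_, _, hctrl, hlen⟩
  · exact le_csInf ⟨_, _, _, hctrl, rfl⟩ hγmin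
  · obtain ⟨u, v, huv⟩ := hγ'.2
    exact le_csInf ⟨_, u, v, huv, rfl⟩ (hmin γ' hγ' h0 h1)
end
end
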